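/- arXiv:2410.04464 — 7 statements merged into one kernel-verified Lean document; each statement's English description precedes it below -/
import Mathlib

section
/- Let λ ∈ ℝ, let Y be a real random variable whose moment generating function exists in a neighborhood of the origin, let x ∈ [0,1], and let n ≥ k ≥ 0 be integers. Then B_{k,n}^Y(x|λ) = ∑_{j=0}^{n-k} C(n,k) · (x)_{k,λ} · C(1−x, j) · j! · {n−k \brace j}_{Y,λ}. -/
open MeasureTheory Filter Finset Topology

/-- The degenerate falling factorial `(x)_{n,λ} = x(x-λ)(x-2λ)⋯(x-(n-1)λ)`. -/
noncomputable def degFallFac (lam x : ℝ) : ℕ → ℝ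
  | 0 => 1
  | n + 1 => degFallFac lam x n * (x - n * lam)

/-- The degenerate exponential `e_λ^y(t) = (1+λt)^{y/λ}` for `λ ≠ 0`, and `e^{yt}` for `λ = 0`. -/
noncomputable def degExp (lam y t : ℝ) : ℝ :=
  if lam = 0 then Real.exp (y * t) else (1 + lam * t) ^ (y / lam)

/-- The generalized binomial coefficient `C(a,j) = a(a-1)⋯(a-j+1)/j!`. -/
noncomputable def genBinom (a : ℝ) (j : ℕ) : ℝ :=
  (∏ i ∈ Finset.range j, (a - (i : ℝ))) / (j.factorial : ℝ)

/-- The degenerate binomial coefficient `C_λ(x,k) = (x)_{k,λ}/k!`. -/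
noncomputable def degBinom (lam x : ℝ) (k : ℕ) : ℝ :=
  degFallFac lam x k / (k.factorial : ℝ)

/-- A convergent real power series agrees with its partial sums of length `N` up to `O(t ^ N)`. -/
theorem isBigO_sub_sum_range_of_hasSum {c : ℕ → ℝ} {F : ℝ → ℝ}
    (hF : ∀ᶠ t in 𝓝 (0 : ℝ), HasSum (fun i : ℕ => c i * t ^ i) (F t)) (N : ℕ) :
    (fun t => F t - ∑ i ∈ Finset.range N, c i * t ^ i) =O[𝓝 0] fun t => t ^ N := by
  have hps : HasFPowerSeriesAt F (FormalMultilinearSeries.ofScalars ℝ c) 0 := by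
    rw [hasFPowerSeriesAt_iff]
    filter_upwards [hF] with t ht
    simpa [FormalMultilinearSeries.coeff_ofScalars, mul_comm] using ht
  have h := hps.isBigO_sub_partialSum_pow N
  simp only [zero_add, FormalMultilinearSeries.partialSum,
    FormalMultilinearSeries.ofScalars_apply_eq, smul_eq_mul, ← norm_pow,
    Asymptotics.isBigO_norm_right] at h
  exact h

/-- If the sum of a convergent power series is `O(t ^ N)`, its first `N` coefficients vanish. -/
theorem coeff_eq_zero_of_hasSum_of_isBigO {c : ℕ → ℝ} {F : ℝ → ℝ} {N : ℕ}
    (hF : ∀ᶠ t in 𝓝 (0 : ℝ), HasSum (fun i : ℕ => c i * t ^ i) (F t))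
    (hO : F =O[𝓝 0] fun t => t ^ N) {m : ℕ} (hm : m < N) : c m = 0 := by
  induction m using Nat.strong_induction_on with
  | _ m ih =>
    have hsum : ∀ t : ℝ, ∑ i ∈ Finset.range (m + 1), c i * t ^ i = c m * t ^ m := fun t => by
      rw [Finset.sum_range_succ, Finset.sum_eq_zero, zero_add]
      intro i hi
      have hi' := Finset.mem_range.mp hi
      rw [ih i hi' (hi'.trans hm), zero_mul]
    have h1 := isBigO_sub_sum_range_of_hasSum hF (m + 1)
    simp only [hsum] at h1
    have h2 : F =O[𝓝 0] fun t => t ^ (m + 1) :=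
      hO.trans <| (Nat.succ_le_of_lt hm).eq_or_lt.elim
        (fun h => h ▸ Asymptotics.isBigO_refl _ _)
        fun h => (Asymptotics.isLittleO_pow_pow h).isBigO
    have h3 : (fun t => c m * t ^ m) =O[𝓝 (0 : ℝ)] fun t => t ^ (m + 1) := by
      simpa using h2.sub h1
    have h4 : (fun t : ℝ => c m * t ^ m) =o[𝓝[≠] (0 : ℝ)] fun t => t ^ m :=
      (h3.trans_isLittleO (Asymptotics.isLittleO_pow_pow (Nat.lt_succ_self m))).mono
        nhdsWithin_le_nhds
    have h5 : Tendsto (fun _ : ℝ => c m) (𝓝[≠] (0 : ℝ)) (𝓝 0) := by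
      refine h4.tendsto_div_nhds_zero.congr' ?_
      filter_upwards [self_mem_nhdsWithin] with t ht
      exact mul_div_cancel_right₀ _ (pow_ne_zero _ ht)
    exact tendsto_nhds_unique tendsto_const_nhds h5

/-- If the sums of two convergent power series differ by `O(t ^ N)`, then their first `N`
coefficients agree. -/
theorem coeff_eq_of_hasSum_of_isBigO_sub {a b : ℕ → ℝ} {F G : ℝ → ℝ} {N : ℕ}
    (hF : ∀ᶠ t in 𝓝 (0 : ℝ), HasSum (fun i : ℕ => a i * t ^ i) (F t))
    (hG : ∀ᶠ t in 𝓝 (0 : ℝ), HasSum (fun i : ℕ => b i * t ^ i) (G t))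
    (hO : (fun t => F t - G t) =O[𝓝 0] fun t => t ^ N) {m : ℕ} (hm : m < N) : a m = b m := by
  have h : ∀ᶠ t in 𝓝 (0 : ℝ), HasSum (fun i : ℕ => (a i - b i) * t ^ i) (F t - G t) := by
    filter_upwards [hF, hG] with t h1 h2
    simpa only [sub_mul] using h1.sub h2
  exact sub_eq_zero.mp (coeff_eq_zero_of_hasSum_of_isBigO h hO hm)

theorem genBinom_eq_choose (a : ℝ) (j : ℕ) : genBinom a j = Ring.choose a j := by
  rw [Ring.choose_eq_smul, ← Polynomial.aeval_eq_smeval, Polynomial.aeval_def,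
    ← Polynomial.eval_map, descPochhammer_map, descPochhammer_eval_eq_prod_range, genBinom,
    smul_eq_mul, div_eq_inv_mul]

/-- Newton's binomial expansion of `(1 + u) ^ a` with remainder. -/
theorem isBigO_one_add_rpow_sub_sum_genBinom (a : ℝ) (N : ℕ) :
    (fun u : ℝ => (1 + u) ^ a - ∑ j ∈ Finset.range N, genBinom a j * u ^ j) =O[𝓝 0]
      fun u => u ^ N := by
  refine isBigO_sub_sum_range_of_hasSum ?_ N
  have h := Real.one_add_rpow_hasFPowerSeriesAt_zero (a := a)
  rw [hasFPowerSeriesAt_iff] at h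
  filter_upwards [h] with u hu
  simpa [binomialSeries, FormalMultilinearSeries.coeff_ofScalars, mul_comm,
    genBinom_eq_choose] using hu

/-- Multiplying a power series by `t ^ k` shifts its coefficients. -/
theorem hasSum_pow_mul_shift {c : ℕ → ℝ} {t s : ℝ} (h : HasSum (fun i : ℕ => c i * t ^ i) s)
    (k : ℕ) :
    HasSum (fun i : ℕ => (if k ≤ i then c (i - k) else 0) * t ^ i) (t ^ k * s) := by
  rw [← hasSum_nat_add_iff' k]
  have h0 : ∑ i ∈ Finset.range k, (if k ≤ i then c (i - k) else 0) * t ^ i = 0 :=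
    Finset.sum_eq_zero fun i hi => by
      rw [if_neg (not_le.mpr (Finset.mem_range.mp hi)), zero_mul]
  rw [h0, sub_zero]
  refine (h.mul_left (t ^ k)).congr_fun ?_
  intro i
  simp [pow_add]
  ring

/-- **Theorem 2.1.**  Explicit expression for the probabilistic degenerate Bernstein
polynomials `B_{k,n}^Y(x|λ)` in terms of the probabilistic degenerate Stirling numbers
of the second kind `{n-k brace j}_{Y,λ}`. -/
theorem probabilistic_degenerate_Bernstein_eq_sum_stirling
    {Ω : Type*} [MeasurableSpace Ω] (μ : Measure Ω) [IsProbabilityMeasure μ]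
    (Y : Ω → ℝ) (hYm : Measurable Y)
    (hmgf : ∃ r > (0 : ℝ), ∀ t : ℝ, |t| < r → Integrable (fun ω => Real.exp (t * Y ω)) μ)
    (lam x : ℝ) (hx : x ∈ Set.Icc (0 : ℝ) 1)
    -- `St n k = {n brace k}_{Y,λ}`, the probabilistic degenerate Stirling numbers of the
    -- second kind, defined by `(1/k!)(E[e_λ^Y(t)]-1)^k = ∑_{n≥k} St n k · t^n/n!`:
    (St : ℕ → ℕ → ℝ)
    (hSt0 : ∀ n k : ℕ, n < k → St n k = 0)
    (hSt : ∀ k : ℕ, ∀ᶠ t in 𝓝 (0 : ℝ),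
      HasSum (fun n : ℕ => St n k * t ^ n / (n.factorial : ℝ))
        ((1 / (k.factorial : ℝ)) * ((∫ ω, degExp lam (Y ω) t ∂μ) - 1) ^ k))
    -- `B k n = B_{k,n}^Y(x|λ)`, the probabilistic degenerate Bernstein polynomials,
    -- defined by `(1/k!)(x)_{k,λ} t^k (E[e_λ^Y(t)])^{1-x} = ∑_{n≥k} B k n · t^n/n!`:
    (B : ℕ → ℕ → ℝ)
    (hB0 : ∀ k n : ℕ, n < k → B k n = 0)
    (hB : ∀ k : ℕ, ∀ᶠ t in 𝓝 (0 : ℝ),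
      HasSum (fun n : ℕ => B k n * t ^ n / (n.factorial : ℝ))
        ((1 / (k.factorial : ℝ)) * degFallFac lam x k * t ^ k *
          (∫ ω, degExp lam (Y ω) t ∂μ) ^ (1 - x)))
    (n k : ℕ) (hkn : k ≤ n) :
    B k n = ∑ j ∈ Finset.range (n - k + 1),
      (n.choose k : ℝ) * degFallFac lam x k * genBinom (1 - x) j *
        (j.factorial : ℝ) * St (n - k) j := by
  set f : ℝ → ℝ := fun t => ∫ ω, degExp lam (Y ω) t ∂μ
  set d : ℝ := 1 / (k.factorial : ℝ) * degFallFac lam x k with hd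
  obtain ⟨m, rfl⟩ := Nat.exists_eq_add_of_le hkn
  rw [Nat.add_sub_cancel_left]
  have hSt' : ∀ j : ℕ, ∀ᶠ t in 𝓝 (0 : ℝ),
      HasSum (fun i : ℕ => St i j / (i.factorial : ℝ) * t ^ i)
        (1 / (j.factorial : ℝ) * (f t - 1) ^ j) := fun j => by
    filter_upwards [hSt j] with t ht
    exact ht.congr_fun fun i => by ring
  have hf1 : (fun t => f t - 1) =O[𝓝 0] fun t => t := by
    have h := isBigO_sub_sum_range_of_hasSum (hSt' 1) 1
    simpa [hSt0 0 1 zero_lt_one] using h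
  have hf0 : Tendsto (fun t => f t - 1) (𝓝 0) (𝓝 0) := hf1.trans_tendsto tendsto_id
  have hF : ∀ᶠ t in 𝓝 (0 : ℝ), HasSum (fun i : ℕ => B k i / (i.factorial : ℝ) * t ^ i)
      (d * (t ^ k * f t ^ (1 - x))) := by
    filter_upwards [hB k] with t ht
    rw [← mul_assoc]
    exact ht.congr_fun fun i => by ring
  have hG : ∀ᶠ t in 𝓝 (0 : ℝ), HasSum
      (fun i : ℕ => (∑ j ∈ Finset.range (m + 1), d * genBinom (1 - x) j * (j.factorial : ℝ) *
        (if k ≤ i then St (i - k) j / ((i - k).factorial : ℝ) else 0)) * t ^ i)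
      (d * (t ^ k * ∑ j ∈ Finset.range (m + 1), genBinom (1 - x) j * (f t - 1) ^ j)) := by
    filter_upwards [eventually_all.mpr fun j : Fin (m + 1) => hSt' j] with t ht
    have ht' : ∀ j ∈ Finset.range (m + 1), HasSum
        (fun i : ℕ => St i j / (i.factorial : ℝ) * t ^ i)
        (1 / (j.factorial : ℝ) * (f t - 1) ^ j) :=
      fun j hj => ht ⟨j, Finset.mem_range.mp hj⟩
    have h := hasSum_sum fun j hj =>
      (hasSum_pow_mul_shift (ht' j hj) k).mul_left
        (d * genBinom (1 - x) j * (j.factorial : ℝ))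
    have hval : d * (t ^ k * ∑ j ∈ Finset.range (m + 1), genBinom (1 - x) j * (f t - 1) ^ j) =
        ∑ j ∈ Finset.range (m + 1), d * genBinom (1 - x) j * (j.factorial : ℝ) *
          (t ^ k * (1 / (j.factorial : ℝ) * (f t - 1) ^ j)) := by
      rw [Finset.mul_sum, Finset.mul_sum]
      refine Finset.sum_congr rfl fun j _ => ?_
      have hj : (j.factorial : ℝ) ≠ 0 := Nat.cast_ne_zero.mpr j.factorial_ne_zero
      field_simp
    rw [hval]
    refine h.congr_fun fun i => ?_
    rw [Finset.sum_mul]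
    exact Finset.sum_congr rfl fun j _ => by ring
  have hO : (fun t => d * (t ^ k * f t ^ (1 - x)) -
      d * (t ^ k * ∑ j ∈ Finset.range (m + 1), genBinom (1 - x) j * (f t - 1) ^ j))
      =O[𝓝 0] fun t => t ^ (k + (m + 1)) := by
    have h := ((isBigO_one_add_rpow_sub_sum_genBinom (1 - x) (m + 1)).comp_tendsto hf0).trans
      (hf1.pow (m + 1))
    simp only [Function.comp_def, add_sub_cancel] at h
    simpa only [← mul_sub, pow_add] using
      ((Asymptotics.isBigO_refl (fun t : ℝ => t ^ k) (𝓝 0)).mul h).const_mul_left d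
  have key := coeff_eq_of_hasSum_of_isBigO_sub hF hG hO (m := k + m) (by omega)
  rw [div_eq_iff (Nat.cast_ne_zero.mpr (Nat.factorial_ne_zero _)), Finset.sum_mul] at key
  rw [key]
  refine Finset.sum_congr rfl fun j _ => ?_
  have hfac : ((k + m).factorial : ℝ) =
      ((k + m).choose k : ℝ) * (k.factorial : ℝ) * (m.factorial : ℝ) := by
    have h := Nat.choose_mul_factorial_mul_factorial (Nat.le_add_right k m)
    rw [Nat.add_sub_cancel_left] at h
    exact_mod_cast h.symm
  have hk : (k.factorial : ℝ) ≠ 0 := Nat.cast_ne_zero.mpr k.factorial_ne_zero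
  have hm : (m.factorial : ℝ) ≠ 0 := Nat.cast_ne_zero.mpr m.factorial_ne_zero
  rw [if_pos (Nat.le_add_right k m), Nat.add_sub_cancel_left, hfac, hd]
  field_simp
end

section
/- Let λ ∈ ℝ, let Y be a real random variable whose moment generating function exists in a neighborhood of the origin, let x ∈ [0,1], and let n ≥ k ≥ 0 be integers. Then B_{k,n}^Y(x|λ) = (x)_{k,λ} · ∑_{m=k}^{n} C(n,m) · {m \brace k}_{Y,λ} · β_{n−m,λ}^{(k,Y)}(1−x). -/
open MeasureTheory Filter Finset Topology

theorem eventually_ne_one_of_eventuallyEq_mgf_comp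
    {Ω : Type*} [MeasurableSpace Ω] {μ : Measure Ω} [IsProbabilityMeasure μ] {Y : Ω → ℝ}
    (h0 : (0 : ℝ) ∈ interior (ProbabilityTheory.integrableExpSet Y μ))
    (hEY : (∫ ω, Y ω ∂μ) ≠ 0) {g : ℝ → ℝ} (hg0 : g 0 = 0) (hg : HasDerivAt g 1 0)
    {F : ℝ → ℝ} (hF : F =ᶠ[𝓝 0] fun t => ProbabilityTheory.mgf Y μ (g t)) :
    ∀ᶠ t in 𝓝[≠] (0 : ℝ), F t ≠ 1 := by
  have hM : HasDerivAt (ProbabilityTheory.mgf Y μ) (∫ ω, Y ω ∂μ) (g 0) := by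
    simpa [hg0] using ProbabilityTheory.hasDerivAt_mgf h0
  have hcomp := (hM.comp (0 : ℝ) hg).congr_of_eventuallyEq hF
  exact hcomp.eventually_ne (by simpa using hEY)

theorem zero_mem_interior_integrableExpSet {Ω : Type*} [MeasurableSpace Ω] {μ : Measure Ω}
    {Y : Ω → ℝ}
    (hmgf : ∃ r > (0 : ℝ), ∀ t : ℝ, |t| < r → Integrable (fun ω => Real.exp (t * Y ω)) μ) :
    (0 : ℝ) ∈ interior (ProbabilityTheory.integrableExpSet Y μ) := by
  obtain ⟨r, hr, h⟩ := hmgf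
  rw [mem_interior_iff_mem_nhds]
  filter_upwards [Metric.ball_mem_nhds (0 : ℝ) hr] with t ht
  exact h t (by simpa using ht)

/-- Where the moment generating function exists and `E[Y] ≠ 0`, the function
`t ↦ E[e_λ^Y(t)] - 1` has an isolated zero at the origin. -/
theorem eventually_integral_degExp_ne_one
    {Ω : Type*} [MeasurableSpace Ω] {μ : Measure Ω} [IsProbabilityMeasure μ] {Y : Ω → ℝ}
    (hmgf : ∃ r > (0 : ℝ), ∀ t : ℝ, |t| < r → Integrable (fun ω => Real.exp (t * Y ω)) μ)
    (hEY : (∫ ω, Y ω ∂μ) ≠ 0) (lam : ℝ) :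
    ∀ᶠ t in 𝓝[≠] (0 : ℝ), (∫ ω, degExp lam (Y ω) t ∂μ) ≠ 1 := by
  have h0 := zero_mem_interior_integrableExpSet hmgf
  by_cases hl : lam = 0
  · refine eventually_ne_one_of_eventuallyEq_mgf_comp h0 hEY (g := id) rfl
      (hasDerivAt_id 0) (.of_forall fun t => ?_)
    simp [degExp, hl, ProbabilityTheory.mgf, mul_comm]
  · have hlin : HasDerivAt (fun t : ℝ => 1 + lam * t) lam 0 := by
      simpa using ((hasDerivAt_id (0 : ℝ)).const_mul lam).const_add 1
    refine eventually_ne_one_of_eventuallyEq_mgf_comp h0 hEY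
      (g := fun t => Real.log (1 + lam * t) / lam) (by simp) ?_ ?_
    · simpa [hl] using (hlin.log (by simp)).div_const lam
    · have hpos : ∀ᶠ t in 𝓝 (0 : ℝ), 0 < 1 + lam * t :=
        hlin.continuousAt.eventually (lt_mem_nhds (by simp))
      filter_upwards [hpos] with t ht
      simp only [degExp, hl, if_false, ProbabilityTheory.mgf]
      congr 1 with ω
      rw [Real.rpow_def_of_pos ht]
      congr 1
      ring

/-- A real power series summing to zero on a punctured neighborhood of the origin has only zero
coefficients. -/
theorem eq_zero_of_eventually_hasSum_pow_zero {c : ℕ → ℝ}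
    (h : ∀ᶠ t in 𝓝[≠] (0 : ℝ), HasSum (fun n => c n * t ^ n) 0) (n : ℕ) : c n = 0 := by
  have hp : HasFPowerSeriesAt (fun t : ℝ => if t = 0 then c 0 else 0)
      (FormalMultilinearSeries.ofScalars ℝ c) 0 := by
    rw [hasFPowerSeriesAt_iff]
    filter_upwards [eventually_nhdsWithin_iff.mp h] with t ht
    simp only [FormalMultilinearSeries.coeff_ofScalars, smul_eq_mul, zero_add]
    by_cases h0 : t = 0
    · subst h0
      simpa using hasSum_single (f := fun n : ℕ => (0 : ℝ) ^ n * c n) 0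
        (fun m hm => by simp [hm])
    · simpa [h0, mul_comm] using ht h0
  have hz : ∀ᶠ t in 𝓝 (0 : ℝ), (if t = 0 then c 0 else 0) = 0 := by
    rw [← hp.analyticAt.frequently_zero_iff_eventually_zero]
    refine Eventually.frequently ?_
    filter_upwards [self_mem_nhdsWithin] with t ht
    exact if_neg ht
  have hp0 := (hp.congr hz).eq_zero
  rw [← FormalMultilinearSeries.coeff_ofScalars (𝕜 := ℝ) (p := c) (n := n), hp0]
  rfl

/-- Real power series with equal sums on a punctured neighborhood of the origin have the same
coefficients. -/
theorem eq_of_eventually_hasSum_pow {a b : ℕ → ℝ} {f : ℝ → ℝ}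
    (ha : ∀ᶠ t in 𝓝[≠] (0 : ℝ), HasSum (fun n => a n * t ^ n) (f t))
    (hb : ∀ᶠ t in 𝓝[≠] (0 : ℝ), HasSum (fun n => b n * t ^ n) (f t)) (n : ℕ) : a n = b n := by
  refine sub_eq_zero.mp (eq_zero_of_eventually_hasSum_pow_zero (c := fun n => a n - b n) ?_ n)
  filter_upwards [ha, hb] with t h1 h2
  simpa [sub_mul] using h1.sub h2

/-- The product of two exponential generating series is the exponential generating series of the
binomial convolution. -/
theorem HasSum.mul_exponential_generating {a b : ℕ → ℝ} {t A B : ℝ}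
    (ha : HasSum (fun n : ℕ => a n * t ^ n / (n.factorial : ℝ)) A)
    (hb : HasSum (fun n : ℕ => b n * t ^ n / (n.factorial : ℝ)) B) :
    HasSum (fun n : ℕ => (∑ m ∈ range (n + 1), (n.choose m : ℝ) * a m * b (n - m)) /
      (n.factorial : ℝ) * t ^ n) (A * B) := by
  have h := hasSum_sum_range_mul_of_summable_norm ha.summable.norm hb.summable.norm
  rw [ha.tsum_eq, hb.tsum_eq] at h
  convert! h using 2 with n
  rw [Finset.sum_div, Finset.sum_mul]
  refine Finset.sum_congr rfl fun m hm => ?_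
  have hmn : m ≤ n := Nat.lt_succ_iff.mp (mem_range.mp hm)
  rw [Nat.cast_choose ℝ hmn, ← pow_mul_pow_sub t hmn]
  field_simp

/-- **Theorem 2.2.** `B_{k,n}^Y(x|λ) = (x)_{k,λ} ∑_{m=k}^n C(n,m) {m brace k}_{Y,λ}
β_{n-m,λ}^{(k,Y)}(1-x)`. -/
theorem probabilistic_degenerate_Bernstein_eq_sum_bernoulli
    {Ω : Type*} [MeasurableSpace Ω] (μ : Measure Ω) [IsProbabilityMeasure μ]
    (Y : Ω → ℝ) (hYm : Measurable Y)
    (hmgf : ∃ r > (0 : ℝ), ∀ t : ℝ, |t| < r → Integrable (fun ω => Real.exp (t * Y ω)) μ)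
    (hEY : (∫ ω, Y ω ∂μ) ≠ 0)
    (lam x : ℝ) (hx : x ∈ Set.Icc (0 : ℝ) 1)
    -- probabilistic degenerate Stirling numbers of the second kind:
    (St : ℕ → ℕ → ℝ)
    (hSt0 : ∀ n k : ℕ, n < k → St n k = 0)
    (hSt : ∀ k : ℕ, ∀ᶠ t in 𝓝 (0 : ℝ),
      HasSum (fun n : ℕ => St n k * t ^ n / (n.factorial : ℝ))
        ((1 / (k.factorial : ℝ)) * ((∫ ω, degExp lam (Y ω) t ∂μ) - 1) ^ k))
    -- `βp r y n = β_{n,λ}^{(r,Y)}(y)`, the probabilistic degenerate Bernoulli polynomials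
    -- of order `r`, defined by
    -- `(t/(E[e_λ^Y(t)]-1))^r (E[e_λ^Y(t)])^y = ∑_{n≥0} βp r y n · t^n/n!`:
    (βp : ℕ → ℝ → ℕ → ℝ)
    (hβ : ∀ (r : ℕ) (y : ℝ), ∀ᶠ t in 𝓝[≠] (0 : ℝ),
      HasSum (fun n : ℕ => βp r y n * t ^ n / (n.factorial : ℝ))
        ((t / ((∫ ω, degExp lam (Y ω) t ∂μ) - 1)) ^ r *
          (∫ ω, degExp lam (Y ω) t ∂μ) ^ y))
    -- probabilistic degenerate Bernstein polynomials:
    (B : ℕ → ℕ → ℝ)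
    (hB0 : ∀ k n : ℕ, n < k → B k n = 0)
    (hB : ∀ k : ℕ, ∀ᶠ t in 𝓝 (0 : ℝ),
      HasSum (fun n : ℕ => B k n * t ^ n / (n.factorial : ℝ))
        ((1 / (k.factorial : ℝ)) * degFallFac lam x k * t ^ k *
          (∫ ω, degExp lam (Y ω) t ∂μ) ^ (1 - x)))
    (n k : ℕ) (hkn : k ≤ n) :
    B k n = degFallFac lam x k * ∑ m ∈ Finset.Icc k n,
      (n.choose m : ℝ) * St m k * βp k (1 - x) (n - m) := by
  have key : B k n / (n.factorial : ℝ) = degFallFac lam x k *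
      ((∑ m ∈ range (n + 1), (n.choose m : ℝ) * St m k * βp k (1 - x) (n - m)) /
        (n.factorial : ℝ)) := by
    refine eq_of_eventually_hasSum_pow
      (f := fun t => (1 / (k.factorial : ℝ)) * degFallFac lam x k * t ^ k *
        (∫ ω, degExp lam (Y ω) t ∂μ) ^ (1 - x))
      (a := fun n => B k n / (n.factorial : ℝ))
      (b := fun n => degFallFac lam x k *
        ((∑ m ∈ range (n + 1), (n.choose m : ℝ) * St m k * βp k (1 - x) (n - m)) /
          (n.factorial : ℝ))) ?_ ?_ n
    · filter_upwards [(hB k).filter_mono nhdsWithin_le_nhds] with t ht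
      simpa only [div_mul_eq_mul_div] using ht
    · filter_upwards [(hSt k).filter_mono nhdsWithin_le_nhds, hβ k (1 - x),
        eventually_integral_degExp_ne_one hmgf hEY lam] with t h1 h2 hne
      have hne' : (∫ ω, degExp lam (Y ω) t ∂μ) - 1 ≠ 0 := sub_ne_zero.mpr hne
      have h3 := (h1.mul_exponential_generating h2).mul_left (degFallFac lam x k)
      simp only [← mul_assoc] at h3 ⊢
      convert! h3 using 1
      rw [div_pow]
      field_simp
  have hsum : ∑ m ∈ Finset.Icc k n, (n.choose m : ℝ) * St m k * βp k (1 - x) (n - m) =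
      ∑ m ∈ range (n + 1), (n.choose m : ℝ) * St m k * βp k (1 - x) (n - m) := by
    refine Finset.sum_subset (fun m hm => ?_) fun m hm hm' => ?_
    · simp only [mem_Icc, mem_range] at *
      omega
    · simp only [mem_Icc, mem_range] at *
      rw [hSt0 m k (by omega)]
      simp
  rw [hsum]
  field_simp at key
  exact key
end

section
/- Let λ ∈ ℝ, let Y be a real random variable whose moment generating function exists in a neighborhood of the origin, let x ∈ [0,1] with (x)_{k,λ} ≠ 0, and let n ≥ k ≥ 0 be integers. Then E[(Y)_{n−k,λ}] = ∑_{l=0}^{n−k} ∑_{j=0}^{l} (C(x,j) / C_λ(x,k)) · (j!/k!) · {l \brace j}_{Y,λ} · (C(n,l)/C(n,k)) · B_{k,n−l}^Y(x|λ). -/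
open MeasureTheory Filter Finset Topology

/-- `f` is the sum of the formal power series `p` in a neighborhood of the origin. -/
def HasRealPowerSeries (f : ℝ → ℝ) (p : PowerSeries ℝ) : Prop :=
  ∀ᶠ t in 𝓝 (0 : ℝ), HasSum (fun n : ℕ => PowerSeries.coeff n p * t ^ n) (f t)

namespace HasRealPowerSeries

variable {f g : ℝ → ℝ} {p q : PowerSeries ℝ}

theorem hasFPowerSeriesAt (hf : HasRealPowerSeries f p) :
    HasFPowerSeriesAt f
      (FormalMultilinearSeries.ofScalars ℝ fun n => PowerSeries.coeff n p) 0 := by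
  rw [hasFPowerSeriesAt_iff]
  filter_upwards [hf] with t ht
  simpa [FormalMultilinearSeries.coeff_ofScalars, mul_comm] using ht

theorem analyticAt (hf : HasRealPowerSeries f p) : AnalyticAt ℝ f 0 :=
  hf.hasFPowerSeriesAt.analyticAt

theorem exists_of_analyticAt (hf : AnalyticAt ℝ f 0) : ∃ p, HasRealPowerSeries f p := by
  obtain ⟨p, hp⟩ := hf
  refine ⟨PowerSeries.mk p.coeff, ?_⟩
  filter_upwards [hasFPowerSeriesAt_iff.mp hp] with t ht
  simpa [mul_comm] using ht

theorem congr (hf : HasRealPowerSeries f p) (h : f =ᶠ[𝓝 0] g) : HasRealPowerSeries g p := by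
  filter_upwards [hf, h] with t ht h
  rwa [← h]

theorem unique (hp : HasRealPowerSeries f p) (hq : HasRealPowerSeries f q) : p = q := by
  have h := hp.hasFPowerSeriesAt.eq_formalMultilinearSeries hq.hasFPowerSeriesAt
  ext n
  simpa [FormalMultilinearSeries.coeff_ofScalars] using congrArg (fun s => s.coeff n) h

theorem zero : HasRealPowerSeries (fun _ => 0) 0 :=
  Eventually.of_forall fun t => by simp

theorem add (hf : HasRealPowerSeries f p) (hg : HasRealPowerSeries g q) :
    HasRealPowerSeries (fun t => f t + g t) (p + q) := by
  filter_upwards [hf, hg] with t hf hg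
  simpa [add_mul] using hf.add hg

theorem const_mul (c : ℝ) (hf : HasRealPowerSeries f p) :
    HasRealPowerSeries (fun t => c * f t) (PowerSeries.C c * p) := by
  filter_upwards [hf] with t hf
  simpa [mul_assoc] using hf.mul_left c

theorem sum {ι : Type*} (s : Finset ι) {f : ι → ℝ → ℝ} {p : ι → PowerSeries ℝ}
    (h : ∀ i ∈ s, HasRealPowerSeries (f i) (p i)) :
    HasRealPowerSeries (fun t => ∑ i ∈ s, f i t) (∑ i ∈ s, p i) := by
  classical
  induction s using Finset.induction_on with
  | empty => simpa using zero
  | insert a s ha ih =>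
    simp only [Finset.sum_insert ha]
    exact (h a (by simp)).add (ih fun i hi => h i (by simp [hi]))

theorem mul (hf : HasRealPowerSeries f p) (hg : HasRealPowerSeries g q) :
    HasRealPowerSeries (fun t => f t * g t) (p * q) := by
  filter_upwards [hf, hg] with t hf hg
  convert! hasSum_sum_range_mul_of_summable_norm hf.summable.norm hg.summable.norm using 1
  · ext n
    rw [PowerSeries.coeff_mul, Finset.sum_mul,
      Finset.Nat.sum_antidiagonal_eq_sum_range_succ_mk]
    refine Finset.sum_congr rfl fun i hi => ?_
    have hin : i ≤ n := Nat.lt_succ_iff.mp (Finset.mem_range.mp hi)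
    rw [← pow_mul_pow_sub t hin]
    ring
  · rw [hf.tsum_eq, hg.tsum_eq]

theorem pow_id (k : ℕ) : HasRealPowerSeries (fun t => t ^ k) (PowerSeries.X ^ k) := by
  refine Eventually.of_forall fun t => ?_
  have h := hasSum_ite_eq k (t ^ k)
  convert! h using 2 with n
  split_ifs with hn <;> simp [PowerSeries.coeff_X_pow, hn]

theorem exists_remainder (hf : HasRealPowerSeries f p) (N : ℕ) :
    ∃ h : ℝ → ℝ, AnalyticAt ℝ h 0 ∧ ∀ᶠ t in 𝓝 (0 : ℝ),
      f t = (∑ j ∈ Finset.range N, PowerSeries.coeff j p * t ^ j) + t ^ N * h t := by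
  have hs : ∀ᶠ t in 𝓝 (0 : ℝ), Summable fun j => PowerSeries.coeff (j + N) p * t ^ j := by
    filter_upwards [hf] with t ht
    rcases eq_or_ne t 0 with rfl | h0
    · exact summable_of_ne_finset_zero (s := {0}) fun j hj => by
        simp [Finset.notMem_singleton.mp hj]
    · refine (((summable_nat_add_iff N).mpr ht.summable).mul_right (t ^ N)⁻¹).congr fun j => ?_
      rw [pow_add]
      field_simp
  let h : ℝ → ℝ := fun t => ∑' j, PowerSeries.coeff (j + N) p * t ^ j
  have hh : HasRealPowerSeries h (PowerSeries.mk fun j => PowerSeries.coeff (j + N) p) := by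
    filter_upwards [hs] with t ht
    simpa using ht.hasSum
  refine ⟨h, hh.analyticAt, ?_⟩
  filter_upwards [hf] with t ht
  rw [← ht.tsum_eq, ← ht.summable.sum_add_tsum_nat_add N]
  congr 1
  simp only [h]
  rw [← tsum_mul_left]
  refine tsum_congr fun j => ?_
  ring

end HasRealPowerSeries

theorem choose_eq_genBinom (a : ℝ) (n : ℕ) : Ring.choose a n = genBinom a n := by
  rw [genBinom, Ring.choose_eq_smul, Polynomial.descPochhammer_smeval_eq_ascPochhammer,
    Polynomial.ascPochhammer_smeval_cast, Polynomial.ascPochhammer_smeval_eq_eval,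
    ← descPochhammer_eval_eq_ascPochhammer, descPochhammer_eval_eq_prod_range]
  simp [div_eq_inv_mul]

theorem hasSum_genBinom_mul_pow (a : ℝ) {t : ℝ} (ht : |t| < 1) :
    HasSum (fun n => genBinom a n * t ^ n) ((1 + t) ^ a) := by
  have h := (Real.one_add_rpow_hasFPowerSeriesOnBall_zero (a := a)).hasSum
    (y := t) (by simpa [enorm_eq_nnnorm, ← NNReal.coe_lt_one] using ht)
  simpa [binomialSeries, FormalMultilinearSeries.coeff_ofScalars, choose_eq_genBinom, mul_comm]
    using h

theorem degFallFac_eq_prod (lam y : ℝ) (n : ℕ) :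
    degFallFac lam y n = ∏ i ∈ Finset.range n, (y - i * lam) := by
  induction n with
  | zero => rfl
  | succ n ih => rw [degFallFac, ih, Finset.prod_range_succ]

theorem hasSum_degFallFac (lam y : ℝ) {t : ℝ} (ht : |lam * t| < 1) :
    HasSum (fun n => degFallFac lam y n * t ^ n / (n.factorial : ℝ)) (degExp lam y t) := by
  rcases eq_or_ne lam 0 with rfl | hl
  · have h := NormedSpace.expSeries_div_hasSum_exp (y * t)
    rw [← Real.exp_eq_exp_ℝ] at h
    simpa [degExp, degFallFac_eq_prod, mul_pow] using h
  · have h := hasSum_genBinom_mul_pow (y / lam) ht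
    rw [degExp, if_neg hl]
    convert! h using 2 with n
    rw [degFallFac_eq_prod, genBinom, mul_pow]
    have : ∀ i : ℕ, y - i * lam = (y / lam - i) * lam := fun i => by field_simp
    simp only [this, Finset.prod_mul_distrib, Finset.prod_const, Finset.card_range]
    ring

theorem abs_degFallFac_le (lam y : ℝ) (n : ℕ) :
    |degFallFac lam y n| ≤ degFallFac (-|lam|) |y| n := by
  rw [degFallFac_eq_prod, degFallFac_eq_prod, Finset.abs_prod]
  refine Finset.prod_le_prod (fun _ _ => abs_nonneg _) fun i _ => ?_
  calc |y - i * lam| ≤ |y| + |i * lam| := abs_sub _ _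
    _ = |y| - i * -|lam| := by rw [abs_mul, Nat.abs_cast]; ring

/-- The degenerate exponential is an ordinary exponential at a point that is small with `t`. -/
theorem exists_degExp_eq_exp (lam : ℝ) : ∃ s : ℝ → ℝ, Tendsto s (𝓝 0) (𝓝 0) ∧
    ∀ᶠ t in 𝓝 (0 : ℝ), ∀ y, degExp lam y t = Real.exp (s t * y) := by
  rcases eq_or_ne lam 0 with rfl | hl
  · exact ⟨id, tendsto_id, Eventually.of_forall fun t y => by simp [degExp, mul_comm]⟩
  · have hc : ContinuousAt (fun t => 1 + lam * t) 0 := by fun_prop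
    refine ⟨fun t => Real.log (1 + lam * t) / lam, ?_, ?_⟩
    · have h : ContinuousAt (fun t => Real.log (1 + lam * t) / lam) 0 :=
        (hc.log (by simp)).div_const lam
      simpa [ContinuousAt] using h
    · filter_upwards [hc.eventually (lt_mem_nhds (a := 0) (by simp))] with t ht y
      rw [degExp, if_neg hl, Real.rpow_def_of_pos ht]
      congr 1
      ring

theorem measurable_degFallFac (lam : ℝ) (n : ℕ) : Measurable fun y => degFallFac lam y n := by
  simp only [degFallFac_eq_prod]
  fun_prop

section Expectation

variable {Ω : Type*} [MeasurableSpace Ω] {μ : Measure Ω} {Y : Ω → ℝ}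

theorem eventually_integrable_degExp_abs (hYm : Measurable Y)
    (hmgf : ∃ r > (0 : ℝ), ∀ t : ℝ, |t| < r → Integrable (fun ω => Real.exp (t * Y ω)) μ)
    (lam : ℝ) : ∀ᶠ t in 𝓝 (0 : ℝ), Integrable (fun ω => degExp lam |Y ω| t) μ := by
  obtain ⟨r, hr, hint⟩ := hmgf
  obtain ⟨s, hs, hexp⟩ := exists_degExp_eq_exp lam
  have hs' : ∀ᶠ t in 𝓝 (0 : ℝ), |s t| < r := by
    simpa using hs.eventually (Metric.ball_mem_nhds 0 hr)
  filter_upwards [hexp, hs'] with t ht hst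
  simp only [ht]
  refine ((hint _ hst).add (hint (-s t) (by rwa [abs_neg]))).mono'
    (by fun_prop) (Eventually.of_forall fun ω => ?_)
  rw [Real.norm_of_nonneg (Real.exp_nonneg _)]
  rcases abs_choice (Y ω) with h | h <;> rw [h]
  · exact le_add_of_nonneg_right (Real.exp_nonneg _)
  · simpa using Real.exp_nonneg (s t * Y ω)

theorem hasRealPowerSeries_integral_degExp (hYm : Measurable Y)
    (hmgf : ∃ r > (0 : ℝ), ∀ t : ℝ, |t| < r → Integrable (fun ω => Real.exp (t * Y ω)) μ)
    (lam : ℝ) : HasRealPowerSeries (fun t => ∫ ω, degExp lam (Y ω) t ∂μ)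
      (PowerSeries.mk fun n => (∫ ω, degFallFac lam (Y ω) n ∂μ) / (n.factorial : ℝ)) := by
  have habs : Tendsto (fun t : ℝ => |t|) (𝓝 0) (𝓝 0) := by
    simpa using (continuous_abs.tendsto (0 : ℝ))
  have hsmall : ∀ᶠ t in 𝓝 (0 : ℝ), |lam * t| < 1 :=
    ContinuousAt.eventually_lt (by fun_prop) (by fun_prop) (by simp)
  filter_upwards [habs.eventually (eventually_integrable_degExp_abs hYm hmgf (-|lam|)), hsmall]
    with t hint ht
  have hbound (ω : Ω) := hasSum_degFallFac (-|lam|) |Y ω| (t := |t|)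
    (by simpa [abs_mul] using ht)
  have h := hasSum_integral_of_dominated_convergence (μ := μ)
    (F := fun n ω => degFallFac lam (Y ω) n * t ^ n / (n.factorial : ℝ))
    (fun n ω => degFallFac (-|lam|) |Y ω| n * |t| ^ n / (n.factorial : ℝ))
    (fun n => ((((measurable_degFallFac lam n).comp hYm).mul_const _).div_const
      _).aestronglyMeasurable)
    (fun n => Eventually.of_forall fun ω => by
      rw [Real.norm_eq_abs, abs_div, abs_mul, abs_pow, Nat.abs_cast]
      gcongr
      exact abs_degFallFac_le lam (Y ω) n)
    (Eventually.of_forall fun ω => (hbound ω).summable)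
    (by simpa only [(hbound _).tsum_eq] using hint)
    (Eventually.of_forall fun ω => hasSum_degFallFac lam (Y ω) ht)
  convert! h using 2 with n
  rw [integral_div, integral_mul_const, PowerSeries.coeff_mk]
  ring

end Expectation

theorem hasRealPowerSeries_mk_div_factorial {f : ℝ → ℝ} {a : ℕ → ℝ}
    (h : ∀ᶠ t in 𝓝 (0 : ℝ), HasSum (fun n : ℕ => a n * t ^ n / (n.factorial : ℝ)) (f t)) :
    HasRealPowerSeries f (PowerSeries.mk fun n => a n / (n.factorial : ℝ)) := by
  filter_upwards [h] with t ht
  convert! ht using 2 with n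
  rw [PowerSeries.coeff_mk]
  ring

/-- The Taylor coefficients of `F ^ x` when those of `(F - 1) ^ j / j!` are `S m j / m!`. -/
theorem exists_hasRealPowerSeries_rpow {F : ℝ → ℝ} (hF : AnalyticAt ℝ F 0) (hF0 : F 0 = 1)
    (x : ℝ) {S : ℕ → ℕ → ℝ} (hS0 : ∀ n k : ℕ, n < k → S n k = 0)
    (hS : ∀ k : ℕ, HasRealPowerSeries (fun t => (1 / (k.factorial : ℝ)) * (F t - 1) ^ k)
      (PowerSeries.mk fun n => S n k / (n.factorial : ℝ))) (n : ℕ) :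
    ∃ P : PowerSeries ℝ, HasRealPowerSeries (fun t => F t ^ x) P ∧ ∀ l ≤ n,
      PowerSeries.coeff l P =
        ∑ j ∈ Finset.range (l + 1), genBinom x j * j.factorial * (S l j / l.factorial) := by
  have hbin : HasRealPowerSeries (fun u => (1 + u) ^ x) (PowerSeries.mk (genBinom x)) := by
    filter_upwards [Metric.ball_mem_nhds (0 : ℝ) one_pos] with t ht
    simpa using hasSum_genBinom_mul_pow x (by simpa using ht)
  obtain ⟨h, hh, hrem⟩ := hbin.exists_remainder (n + 1)
  have hsub : AnalyticAt ℝ (fun t => F t - 1) 0 := hF.sub analyticAt_const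
  have hsub0 : (fun t => F t - 1) 0 = 0 := by simp [hF0]
  obtain ⟨q, hq⟩ := HasRealPowerSeries.exists_of_analyticAt
    (AnalyticAt.fun_comp (f := fun t => F t - 1) (x := 0) (hsub0.symm ▸ hh) hsub)
  have hlim : Tendsto (fun t => F t - 1) (𝓝 0) (𝓝 0) := by
    simpa [ContinuousAt, hF0] using hsub.continuousAt
  refine ⟨_, ((HasRealPowerSeries.sum (Finset.range (n + 1)) fun j _ =>
    (hS j).const_mul (genBinom x j * j.factorial)).add
      (((hS (n + 1)).const_mul ((n + 1).factorial : ℝ)).mul hq)).congr ?_, fun l hl => ?_⟩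
  · filter_upwards [hlim.eventually hrem] with t ht
    rw [add_sub_cancel] at ht
    rw [ht]
    congr 1
    · refine Finset.sum_congr rfl fun j _ => ?_
      rw [PowerSeries.coeff_mk]
      field_simp
    · field_simp
  · have hvanish : PowerSeries.coeff l (PowerSeries.C ((n + 1).factorial : ℝ) *
        (PowerSeries.mk fun m => S m (n + 1) / (m.factorial : ℝ)) * q) = 0 := by
      rw [PowerSeries.coeff_mul]
      refine Finset.sum_eq_zero fun ij hij => ?_
      have := Finset.HasAntidiagonal.mem_antidiagonal.mp hij
      rw [PowerSeries.coeff_C_mul, PowerSeries.coeff_mk, hS0 _ _ (by omega)]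
      simp
    rw [map_add, hvanish, add_zero, map_sum]
    simp only [PowerSeries.coeff_C_mul, PowerSeries.coeff_mk]
    refine (Finset.sum_subset (Finset.range_subset_range.mpr (by omega)) fun j _ hj => ?_).symm
    rw [hS0 l j (by simpa using hj)]
    simp

/-- **Theorem 2.4.** `E[(Y)_{n-k,λ}] = ∑_{l=0}^{n-k} ∑_{j=0}^{l}
(C(x,j)/C_λ(x,k)) (j!/k!) {l brace j}_{Y,λ} (C(n,l)/C(n,k)) B_{k,n-l}^Y(x|λ)`. -/
theorem expectation_degFallFac_eq_sum_Bernstein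
    {Ω : Type*} [MeasurableSpace Ω] (μ : Measure Ω) [IsProbabilityMeasure μ]
    (Y : Ω → ℝ) (hYm : Measurable Y)
    (hmgf : ∃ r > (0 : ℝ), ∀ t : ℝ, |t| < r → Integrable (fun ω => Real.exp (t * Y ω)) μ)
    (lam x : ℝ) (hx : x ∈ Set.Icc (0 : ℝ) 1)
    -- probabilistic degenerate Stirling numbers of the second kind:
    (St : ℕ → ℕ → ℝ)
    (hSt0 : ∀ n k : ℕ, n < k → St n k = 0)
    (hSt : ∀ k : ℕ, ∀ᶠ t in 𝓝 (0 : ℝ),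
      HasSum (fun n : ℕ => St n k * t ^ n / (n.factorial : ℝ))
        ((1 / (k.factorial : ℝ)) * ((∫ ω, degExp lam (Y ω) t ∂μ) - 1) ^ k))
    -- probabilistic degenerate Bernstein polynomials:
    (B : ℕ → ℕ → ℝ)
    (hB0 : ∀ k n : ℕ, n < k → B k n = 0)
    (hB : ∀ k : ℕ, ∀ᶠ t in 𝓝 (0 : ℝ),
      HasSum (fun n : ℕ => B k n * t ^ n / (n.factorial : ℝ))
        ((1 / (k.factorial : ℝ)) * degFallFac lam x k * t ^ k *
          (∫ ω, degExp lam (Y ω) t ∂μ) ^ (1 - x)))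
    (n k : ℕ) (hkn : k ≤ n) (hxk : degFallFac lam x k ≠ 0) :
    (∫ ω, degFallFac lam (Y ω) (n - k) ∂μ)
      = ∑ l ∈ Finset.range (n - k + 1), ∑ j ∈ Finset.range (l + 1),
          (genBinom x j / degBinom lam x k) * ((j.factorial : ℝ) / (k.factorial : ℝ)) *
            St l j * ((n.choose l : ℝ) / (n.choose k : ℝ)) * B k (n - l) := by
  set F : ℝ → ℝ := fun t => ∫ ω, degExp lam (Y ω) t ∂μ with hFdef
  have hF := hasRealPowerSeries_integral_degExp hYm hmgf lam
  have hF0 : F 0 = 1 := by simp [hFdef, degExp]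
  have hBk := hasRealPowerSeries_mk_div_factorial (hB k)
  obtain ⟨P, hP, hPcoeff⟩ := exists_hasRealPowerSeries_rpow hF.analyticAt hF0 x hSt0
    (fun j => hasRealPowerSeries_mk_div_factorial (hSt j)) n
  have hpos : ∀ᶠ t in 𝓝 (0 : ℝ), 0 < F t :=
    hF.analyticAt.continuousAt.eventually (lt_mem_nhds (by
      change 0 < F 0
      rw [hF0]
      exact one_pos))
  have hprod := (((HasRealPowerSeries.pow_id k).mul hF).const_mul (degBinom lam x k)).congr
    (g := fun t => F t ^ x *
      ((1 / (k.factorial : ℝ)) * degFallFac lam x k * t ^ k * F t ^ (1 - x))) (by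
    filter_upwards [hpos] with t ht
    have hsplit : F t = F t ^ x * F t ^ (1 - x) := by
      rw [← Real.rpow_add ht, add_sub_cancel, Real.rpow_one]
    change degBinom lam x k * (t ^ k * F t) = _
    rw [degBinom]
    linear_combination degFallFac lam x k / k.factorial * t ^ k * hsplit)
  have hcoeff := congrArg (PowerSeries.coeff n) (hprod.unique (hP.mul hBk))
  rw [PowerSeries.coeff_C_mul, PowerSeries.coeff_X_pow_mul', if_pos hkn, PowerSeries.coeff_mk,
    PowerSeries.coeff_mul, Finset.Nat.sum_antidiagonal_eq_sum_range_succ_mk,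
    ← Finset.sum_subset (Finset.range_subset_range.mpr (by omega : n - k + 1 ≤ n + 1))
      (fun l hln hl => by
        simp only [Finset.mem_range] at hln hl
        simp [hB0 k (n - l) (by omega)])] at hcoeff
  have hbin : degBinom lam x k ≠ 0 := by
    rw [degBinom]
    positivity
  have hE : (∫ ω, degFallFac lam (Y ω) (n - k) ∂μ) =
      ((n - k).factorial : ℝ) / degBinom lam x k *
        (degBinom lam x k * ((∫ ω, degFallFac lam (Y ω) (n - k) ∂μ) / (n - k).factorial)) := by
    field_simp
  rw [hE, hcoeff, Finset.mul_sum]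
  refine Finset.sum_congr rfl fun l hl => ?_
  have hln : l ≤ n := by
    simp only [Finset.mem_range] at hl
    omega
  rw [PowerSeries.coeff_mk, hPcoeff l hln, Finset.sum_mul, Finset.mul_sum]
  refine Finset.sum_congr rfl fun j _ => ?_
  rw [Nat.cast_choose ℝ hln, Nat.cast_choose ℝ hkn]
  field_simp
end

section
/- Let λ ∈ ℝ, let Y be a real random variable whose moment generating function exists in a neighborhood of the origin, let x ∈ [0,1] with (x)_{k,λ} ≠ 0, and let n ≥ k ≥ 0 be integers. Then ℰ_{n−k,λ}^Y(1−x) = ∑_{l=k}^{n} (C(n,l) / (C(n,k) · C_λ(x,k))) · ℰ_{n−l,λ}^Y · B_{k,l}^Y(x|λ)/k!. -/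
open MeasureTheory Filter Finset Topology

/-- Two real power series which represent the same function near `0` have the same
coefficients. -/
theorem coeff_eq_of_eventually_hasSum {a b : ℕ → ℝ} {f : ℝ → ℝ}
    (ha : ∀ᶠ t in 𝓝 (0 : ℝ), HasSum (fun n => a n * t ^ n) (f t))
    (hb : ∀ᶠ t in 𝓝 (0 : ℝ), HasSum (fun n => b n * t ^ n) (f t)) : a = b := by
  have key : ∀ c : ℕ → ℝ, (∀ᶠ t in 𝓝 (0 : ℝ), HasSum (fun n => c n * t ^ n) (f t)) →
      HasFPowerSeriesAt f (FormalMultilinearSeries.ofScalars ℝ c) 0 := by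
    intro c hc
    rw [hasFPowerSeriesAt_iff]
    filter_upwards [hc] with t ht
    simpa [FormalMultilinearSeries.coeff_ofScalars, mul_comm] using ht
  have h := (key a ha).eq_formalMultilinearSeries (key b hb)
  funext n
  simpa [FormalMultilinearSeries.coeff_ofScalars] using congrArg (fun p => p.coeff n) h

/-- Cauchy product of exponential generating series at a point. -/
theorem HasSum.mul_exponential {a b : ℕ → ℝ} {t A B : ℝ}
    (ha : HasSum (fun n => a n * t ^ n / (n.factorial : ℝ)) A)
    (hb : HasSum (fun n => b n * t ^ n / (n.factorial : ℝ)) B) :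
    HasSum (fun n => (∑ l ∈ Finset.range (n + 1),
      (n.choose l : ℝ) * a l * b (n - l)) / (n.factorial : ℝ) * t ^ n) (A * B) := by
  have h := hasSum_sum_range_mul_of_summable_norm ha.summable.norm hb.summable.norm
  rw [ha.tsum_eq, hb.tsum_eq] at h
  refine h.congr_fun ?_
  intro n
  rw [Finset.sum_div, Finset.sum_mul]
  refine Finset.sum_congr rfl fun l hl => ?_
  have hln : l ≤ n := Nat.lt_succ_iff.mp (Finset.mem_range.mp hl)
  rw [Nat.cast_choose ℝ hln]
  have h1 : (n.factorial : ℝ) ≠ 0 := mod_cast n.factorial_ne_zero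
  have h2 : t ^ n = t ^ l * t ^ (n - l) := by rw [← pow_add, Nat.add_sub_cancel' hln]
  rw [h2]
  field_simp

/-- Multiplying a power series by `t ^ k` shifts its coefficients. -/
theorem HasSum.pow_mul_shift {a : ℕ → ℝ} {t A : ℝ} (k : ℕ)
    (ha : HasSum (fun n => a n * t ^ n) A) :
    HasSum (fun n => (if k ≤ n then a (n - k) else 0) * t ^ n) (t ^ k * A) := by
  rw [← (add_left_injective k).hasSum_iff]
  · refine (ha.mul_left (t ^ k)).congr_fun fun n => ?_
    simp [pow_add]
    ring
  · intro n hn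
    have : ¬ k ≤ n := fun h => hn ⟨n - k, Nat.sub_add_cancel h⟩
    simp [this]

/-- **Theorem 2.5.** `ℰ_{n-k,λ}^Y(1-x) = ∑_{l=k}^{n}
(C(n,l)/(C(n,k)·C_λ(x,k))) ℰ_{n-l,λ}^Y B_{k,l}^Y(x|λ)/k!`. -/
theorem probabilistic_degenerate_Euler_eq_sum_Bernstein
    {Ω : Type*} [MeasurableSpace Ω] (μ : Measure Ω) [IsProbabilityMeasure μ]
    (Y : Ω → ℝ) (hYm : Measurable Y)
    (hmgf : ∃ r > (0 : ℝ), ∀ t : ℝ, |t| < r → Integrable (fun ω => Real.exp (t * Y ω)) μ)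
    (lam x : ℝ) (hx : x ∈ Set.Icc (0 : ℝ) 1)
    -- `Ep y n = ℰ_{n,λ}^Y(y)`, the probabilistic degenerate Euler polynomials, defined
    -- by `(2/(E[e_λ^Y(t)]+1)) (E[e_λ^Y(t)])^y = ∑_{n≥0} Ep y n · t^n/n!`; the
    -- Euler numbers are `ℰ_{n,λ}^Y = Ep 0 n`:
    (Ep : ℝ → ℕ → ℝ)
    (hEp : ∀ y : ℝ, ∀ᶠ t in 𝓝 (0 : ℝ),
      HasSum (fun n : ℕ => Ep y n * t ^ n / (n.factorial : ℝ))
        ((2 / ((∫ ω, degExp lam (Y ω) t ∂μ) + 1)) *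
          (∫ ω, degExp lam (Y ω) t ∂μ) ^ y))
    -- probabilistic degenerate Bernstein polynomials:
    (B : ℕ → ℕ → ℝ)
    (hB0 : ∀ k n : ℕ, n < k → B k n = 0)
    (hB : ∀ k : ℕ, ∀ᶠ t in 𝓝 (0 : ℝ),
      HasSum (fun n : ℕ => B k n * t ^ n / (n.factorial : ℝ))
        ((1 / (k.factorial : ℝ)) * degFallFac lam x k * t ^ k *
          (∫ ω, degExp lam (Y ω) t ∂μ) ^ (1 - x)))
    (n k : ℕ) (hkn : k ≤ n) (hxk : degFallFac lam x k ≠ 0) :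
    Ep (1 - x) (n - k) = ∑ l ∈ Finset.Icc k n,
      ((n.choose l : ℝ) / ((n.choose k : ℝ) * degBinom lam x k)) * Ep 0 (n - l) *
        (B k l / (k.factorial : ℝ)) := by
  have hprod : ∀ᶠ t in 𝓝 (0 : ℝ), HasSum (fun m => (∑ l ∈ Finset.range (m + 1),
      (m.choose l : ℝ) * B k l * Ep 0 (m - l)) / (m.factorial : ℝ) * t ^ m)
      (t ^ k * (degBinom lam x k * ((2 / ((∫ ω, degExp lam (Y ω) t ∂μ) + 1)) *
        (∫ ω, degExp lam (Y ω) t ∂μ) ^ (1 - x)))) := by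
    filter_upwards [hEp 0, hB k] with t h0 h1
    convert h1.mul_exponential h0 using 1
    rw [Real.rpow_zero, degBinom]
    ring
  have hshift : ∀ᶠ t in 𝓝 (0 : ℝ), HasSum (fun m => (if k ≤ m then
      degBinom lam x k * (Ep (1 - x) (m - k) / ((m - k).factorial : ℝ)) else 0) * t ^ m)
      (t ^ k * (degBinom lam x k * ((2 / ((∫ ω, degExp lam (Y ω) t ∂μ) + 1)) *
        (∫ ω, degExp lam (Y ω) t ∂μ) ^ (1 - x)))) := by
    filter_upwards [hEp (1 - x)] with t h
    refine HasSum.pow_mul_shift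
      (a := fun m => degBinom lam x k * (Ep (1 - x) m / (m.factorial : ℝ))) k ?_
    refine (h.mul_left (degBinom lam x k)).congr_fun fun m => ?_
    ring
  have hcoeff := congrFun (coeff_eq_of_eventually_hasSum hprod hshift) n
  rw [if_pos hkn] at hcoeff
  have hsum : ∑ l ∈ Finset.range (n + 1), (n.choose l : ℝ) * B k l * Ep 0 (n - l) =
      ∑ l ∈ Finset.Icc k n, (n.choose l : ℝ) * B k l * Ep 0 (n - l) := by
    symm
    refine Finset.sum_subset (fun l hl => ?_) fun l hl hl' => ?_
    · simp only [Finset.mem_Icc, Finset.mem_range] at hl ⊢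
      omega
    · simp only [Finset.mem_Icc, Finset.mem_range] at hl hl'
      rw [hB0 k l (by omega)]
      ring
  rw [hsum] at hcoeff
  have hn : (n.factorial : ℝ) ≠ 0 := mod_cast n.factorial_ne_zero
  have hk : (k.factorial : ℝ) ≠ 0 := mod_cast k.factorial_ne_zero
  have hnk : ((n - k).factorial : ℝ) ≠ 0 := mod_cast (n - k).factorial_ne_zero
  have hbinom : degBinom lam x k ≠ 0 := div_ne_zero hxk hk
  have hfactor : ∑ l ∈ Finset.Icc k n,
      ((n.choose l : ℝ) / ((n.choose k : ℝ) * degBinom lam x k)) * Ep 0 (n - l) *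
        (B k l / (k.factorial : ℝ)) =
      (∑ l ∈ Finset.Icc k n, (n.choose l : ℝ) * B k l * Ep 0 (n - l)) /
        ((n.choose k : ℝ) * degBinom lam x k * (k.factorial : ℝ)) := by
    rw [Finset.sum_div]
    refine Finset.sum_congr rfl fun l _ => ?_
    ring
  rw [hfactor, (div_eq_iff hn).mp hcoeff, Nat.cast_choose ℝ hkn]
  field_simp
end

section
/- Let λ ∈ ℝ, let Y be a real random variable whose moment generating function exists in a neighborhood of the origin, let x ∈ [0,1], and let n ≥ k ≥ 0 be integers. Then B_{k,n}^Y(x|λ)/k! = C_λ(x,k) · C(n,k) · ∑_{j=0}^{n−k} ∑_{l=0}^{j} (1−x)^l · S₁(j,l) · {n−k \brace j}_{Y,λ}. -/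
open MeasureTheory Filter Finset Topology

open Asymptotics in
/-- A real function given near `0` by a convergent power series agrees with the partial sums of the
series up to the order of truncation. -/
theorem isBigO_sub_sum_range_of_eventually_hasSum {f : ℝ → ℝ} {c : ℕ → ℝ}
    (h : ∀ᶠ t in 𝓝 (0 : ℝ), HasSum (fun n => c n * t ^ n) (f t)) (N : ℕ) :
    (fun t => f t - ∑ i ∈ Finset.range N, c i * t ^ i) =O[𝓝 0] fun t => t ^ N := by
  have hf : HasFPowerSeriesAt f (FormalMultilinearSeries.ofScalars ℝ c) 0 := by
    rw [hasFPowerSeriesAt_iff]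
    filter_upwards [h] with t ht
    simpa [FormalMultilinearSeries.coeff_ofScalars, mul_comm] using ht
  have := hf.isBigO_sub_partialSum_pow N
  simp only [zero_add, FormalMultilinearSeries.partialSum,
    FormalMultilinearSeries.ofScalars_apply_eq, smul_eq_mul, ← norm_pow] at this
  exact this.of_norm_right

open Asymptotics Polynomial in
/-- A real polynomial vanishing to order `N` at `0` has no coefficients below `N`. -/
theorem Polynomial.coeff_eq_zero_of_isBigO_pow {N : ℕ} {p : ℝ[X]}
    (h : (fun t => p.eval t) =O[𝓝[≠] 0] fun t : ℝ => t ^ N) {i : ℕ} (hi : i < N) :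
    p.coeff i = 0 := by
  induction N generalizing p i with
  | zero => omega
  | succ N ih =>
    have h0 : p.coeff 0 = 0 := by
      have hlim : Tendsto (fun t : ℝ => t ^ (N + 1)) (𝓝[≠] 0) (𝓝 0) := by
        have : Tendsto (fun t : ℝ => t ^ (N + 1)) (𝓝 0) (𝓝 (0 ^ (N + 1))) :=
          (continuous_pow (N + 1)).tendsto 0
        rw [zero_pow N.succ_ne_zero] at this
        exact this.mono_left nhdsWithin_le_nhds
      rw [coeff_zero_eq_eval_zero]
      exact tendsto_nhds_unique (p.continuous.continuousAt.tendsto.mono_left nhdsWithin_le_nhds)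
        (h.trans_tendsto hlim)
    have hp : p.divX * X = p := by simpa [h0] using p.divX_mul_X_add
    have hdiv : (fun t => p.divX.eval t) =O[𝓝[≠] 0] fun t : ℝ => t ^ N := by
      refine ((h.mul (isBigO_refl (fun t : ℝ => t⁻¹) _))).congr' ?_ ?_ <;>
        filter_upwards [self_mem_nhdsWithin] with t ht
      · rw [← hp, eval_mul, eval_X, mul_inv_cancel_right₀ ht, hp]
      · rw [pow_succ, mul_inv_cancel_right₀ ht]
    cases i with
    | zero => exact h0
    | succ i => simpa using ih hdiv (Nat.lt_of_succ_lt_succ hi)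

open Asymptotics in
/-- The Taylor expansion of the real binomial series to order `N`. -/
theorem Real.isBigO_one_add_rpow_sub_sum (a : ℝ) (N : ℕ) :
    (fun u : ℝ => (1 + u) ^ a - ∑ j ∈ Finset.range N,
      (∏ i ∈ Finset.range j, (a - (i : ℝ))) * (1 / (j.factorial : ℝ) * u ^ j))
      =O[𝓝 0] fun u => u ^ N := by
  have hchoose (j : ℕ) : Ring.choose a j =
      (∏ i ∈ Finset.range j, (a - (i : ℝ))) * (1 / (j.factorial : ℝ)) := by
    have h := Ring.descPochhammer_eq_factorial_smul_choose a j
    rw [Polynomial.descPochhammer_smeval_eq_ascPochhammer,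
      Polynomial.ascPochhammer_smeval_eq_eval, ← descPochhammer_eval_eq_ascPochhammer,
      descPochhammer_eval_eq_prod_range, nsmul_eq_mul] at h
    rw [h]
    field_simp
  have h := hasFPowerSeriesAt_iff.mp (Real.one_add_rpow_hasFPowerSeriesAt_zero (a := a))
  simp only [← mul_assoc, ← hchoose]
  refine isBigO_sub_sum_range_of_eventually_hasSum ?_ N
  filter_upwards [h] with t ht
  simpa [binomialSeries, FormalMultilinearSeries.coeff_ofScalars, mul_comm] using ht

open Asymptotics in
/-- If `f - 1` and its divided powers have power series at `0` with coefficients `S i j`, then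
`f ^ a` expands through the binomial series. -/
theorem isBigO_rpow_sub_sum_of_hasSum_pow {f : ℝ → ℝ} {S : ℕ → ℕ → ℝ} (hS0 : S 0 1 = 0)
    (hS : ∀ j : ℕ, ∀ᶠ t in 𝓝 (0 : ℝ),
      HasSum (fun n : ℕ => S n j * t ^ n / (n.factorial : ℝ))
        ((1 / (j.factorial : ℝ)) * (f t - 1) ^ j))
    (a : ℝ) (N : ℕ) :
    (fun t => f t ^ a - ∑ j ∈ Finset.range N, (∏ i ∈ Finset.range j, (a - (i : ℝ))) *
      ∑ i ∈ Finset.range N, S i j / (i.factorial : ℝ) * t ^ i) =O[𝓝 0] fun t => t ^ N := by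
  have hS' (j M : ℕ) : (fun t => (1 / (j.factorial : ℝ)) * (f t - 1) ^ j -
      ∑ i ∈ Finset.range M, S i j / (i.factorial : ℝ) * t ^ i) =O[𝓝 0] fun t => t ^ M :=
    isBigO_sub_sum_range_of_eventually_hasSum
      ((hS j).mono fun t ht => by simpa only [div_mul_eq_mul_div] using ht) M
  have hf : (fun t => f t - 1) =O[𝓝 0] fun t : ℝ => t := by simpa [hS0] using hS' 1 1
  have hlim : Tendsto (fun t => f t - 1) (𝓝 0) (𝓝 0) := hf.trans_tendsto tendsto_id
  have h1 := ((Real.isBigO_one_add_rpow_sub_sum a N).comp_tendsto hlim).trans (hf.pow N)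
  have h2 : (fun t => ∑ j ∈ Finset.range N, (∏ i ∈ Finset.range j, (a - (i : ℝ))) *
      ((1 / (j.factorial : ℝ)) * (f t - 1) ^ j -
        ∑ i ∈ Finset.range N, S i j / (i.factorial : ℝ) * t ^ i)) =O[𝓝 0] fun t => t ^ N :=
    IsBigO.fun_sum fun j _ => (hS' j N).const_mul_left _
  refine (h1.add h2).congr_left fun t => ?_
  simp only [Function.comp_apply, add_sub_cancel, mul_sub, Finset.sum_sub_distrib]
  ring

/-- **Theorem 2.7.** `B_{k,n}^Y(x|λ)/k! = C_λ(x,k) C(n,k)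
∑_{j=0}^{n-k} ∑_{l=0}^{j} (1-x)^l S₁(j,l) {n-k brace j}_{Y,λ}`. -/
theorem probabilistic_degenerate_Bernstein_eq_sum_stirling_first
    {Ω : Type*} [MeasurableSpace Ω] (μ : Measure Ω) [IsProbabilityMeasure μ]
    (Y : Ω → ℝ) (hYm : Measurable Y)
    (hmgf : ∃ r > (0 : ℝ), ∀ t : ℝ, |t| < r → Integrable (fun ω => Real.exp (t * Y ω)) μ)
    (lam x : ℝ) (hx : x ∈ Set.Icc (0 : ℝ) 1)
    -- `S1 j l = S₁(j,l)`, the (signed) Stirling numbers of the first kind, defined by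
    -- `y(y-1)⋯(y-j+1) = ∑_{l=0}^{j} S₁(j,l) y^l`:
    (S1 : ℕ → ℕ → ℝ)
    (hS1 : ∀ (j : ℕ) (y : ℝ),
      (∏ i ∈ Finset.range j, (y - (i : ℝ))) = ∑ l ∈ Finset.range (j + 1), S1 j l * y ^ l)
    -- probabilistic degenerate Stirling numbers of the second kind:
    (St : ℕ → ℕ → ℝ)
    (hSt0 : ∀ n k : ℕ, n < k → St n k = 0)
    (hSt : ∀ k : ℕ, ∀ᶠ t in 𝓝 (0 : ℝ),
      HasSum (fun n : ℕ => St n k * t ^ n / (n.factorial : ℝ))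
        ((1 / (k.factorial : ℝ)) * ((∫ ω, degExp lam (Y ω) t ∂μ) - 1) ^ k))
    -- probabilistic degenerate Bernstein polynomials:
    (B : ℕ → ℕ → ℝ)
    (hB0 : ∀ k n : ℕ, n < k → B k n = 0)
    (hB : ∀ k : ℕ, ∀ᶠ t in 𝓝 (0 : ℝ),
      HasSum (fun n : ℕ => B k n * t ^ n / (n.factorial : ℝ))
        ((1 / (k.factorial : ℝ)) * degFallFac lam x k * t ^ k *
          (∫ ω, degExp lam (Y ω) t ∂μ) ^ (1 - x)))
    (n k : ℕ) (hkn : k ≤ n) :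
    B k n / (k.factorial : ℝ) = degBinom lam x k * (n.choose k : ℝ) *
      ∑ j ∈ Finset.range (n - k + 1), ∑ l ∈ Finset.range (j + 1),
        (1 - x) ^ l * S1 j l * St (n - k) j := by
  obtain ⟨m, rfl⟩ := Nat.exists_eq_add_of_le' hkn
  rw [Nat.add_sub_cancel]
  set c : ℝ := 1 / (k.factorial : ℝ) * degFallFac lam x k with hc
  set d : ℕ → ℝ := fun j => ∏ i ∈ Finset.range j, (1 - x - (i : ℝ)) with hd
  have hB' := isBigO_sub_sum_range_of_eventually_hasSum
    ((hB k).mono fun t ht => by simpa only [← div_mul_eq_mul_div] using ht) (m + 1 + k)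
  have hf := (isBigO_rpow_sub_sum_of_hasSum_pow (hSt0 0 1 one_pos) hSt (1 - x) (m + 1)).mul
    ((Asymptotics.isBigO_refl (fun t : ℝ => t ^ k) (𝓝 0)).const_mul_left c)
  simp only [← pow_add] at hf
  let p : Polynomial ℝ :=
    (∑ j ∈ Finset.range (m + 1), Polynomial.C (d j) * ∑ i ∈ Finset.range (m + 1),
      Polynomial.C (St i j / (i.factorial : ℝ)) * Polynomial.X ^ i) *
        Polynomial.X ^ k * Polynomial.C c -
    ∑ i ∈ Finset.range (m + 1 + k), Polynomial.C (B k i / (i.factorial : ℝ)) * Polynomial.X ^ i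
  have hp : (fun t => p.eval t) =O[𝓝[≠] 0] fun t : ℝ => t ^ (m + 1 + k) := by
    refine ((hB'.sub hf).mono nhdsWithin_le_nhds).congr_left fun t => ?_
    simp only [p, hd, Polynomial.eval_sub, Polynomial.eval_mul, Polynomial.eval_finsetSum,
      Polynomial.eval_C, Polynomial.eval_pow, Polynomial.eval_X]
    ring
  have hcoeff := Polynomial.coeff_eq_zero_of_isBigO_pow hp (i := m + k) (by omega)
  simp only [p, Polynomial.coeff_sub, Polynomial.coeff_mul_C, Polynomial.coeff_mul_X_pow,
    Polynomial.finsetSum_coeff, Polynomial.coeff_C_mul, Polynomial.coeff_X_pow, mul_ite, mul_one,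
    mul_zero, Finset.sum_ite_eq, Finset.mem_range, Nat.lt_succ_self, if_true,
    show m + k < m + 1 + k by omega, ← mul_div_assoc, ← Finset.sum_div] at hcoeff
  have hsum : ∑ j ∈ Finset.range (m + 1), ∑ l ∈ Finset.range (j + 1),
      (1 - x) ^ l * S1 j l * St m j = ∑ j ∈ Finset.range (m + 1), d j * St m j :=
    Finset.sum_congr rfl fun j _ => by
      simp only [hd, hS1, Finset.sum_mul, mul_comm ((1 - x) ^ _)]
  have hchoose : ((m + k).choose k : ℝ) * k.factorial * m.factorial = (m + k).factorial := by
    have := Nat.choose_mul_factorial_mul_factorial (Nat.le_add_left k m)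
    rw [Nat.add_sub_cancel] at this
    exact_mod_cast this
  rw [hsum, degBinom]
  rw [hc, sub_eq_zero] at hcoeff
  rw [← hchoose] at hcoeff
  have hC : ((m + k).choose k : ℝ) ≠ 0 := by
    exact_mod_cast (Nat.choose_pos (Nat.le_add_left k m)).ne'
  have hk : (k.factorial : ℝ) ≠ 0 := by positivity
  have hm : (m.factorial : ℝ) ≠ 0 := by positivity
  rw [eq_div_iff (by positivity)] at hcoeff
  rw [← hcoeff]
  field_simp
end

section
/- Let λ ∈ ℝ, let α > 0, let Y be a Poisson random variable with parameter α, let x ∈ [0,1], and let n ≥ k ≥ 0 be integers. Then B_{k,n}^Y(x|λ)/k! = C_λ(x,k) · C(n,k) · ∑_{j=0}^{n−k} α^j (1−x)^j {n−k \brace j}_λ. -/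
open MeasureTheory Filter Finset Topology

/-- A power series whose sum is `O(t ^ N)` at the origin has vanishing coefficients below `N`. -/
lemma coeff_eq_zero_of_hasSum_of_isBigO_s8 {a : ℕ → ℝ} {f : ℝ → ℝ} {N : ℕ}
    (ha : ∀ᶠ t in 𝓝 (0 : ℝ), HasSum (fun n => a n * t ^ n) (f t))
    (hf : f =O[𝓝 0] fun t => t ^ N) {n : ℕ} (hn : n < N) : a n = 0 := by
  have hp : HasFPowerSeriesAt f (FormalMultilinearSeries.ofScalars ℝ a) 0 := by
    rw [hasFPowerSeriesAt_iff]
    filter_upwards [ha] with t ht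
    simpa [FormalMultilinearSeries.coeff_ofScalars, mul_comm] using ht
  induction n using Nat.strong_induction_on with
  | _ n ih =>
    have h1 := hp.isBigO_sub_partialSum_pow (n + 1)
    have h2 : f =O[𝓝 0] fun t : ℝ => ‖t‖ ^ (n + 1) := by
      refine hf.trans ?_
      simp_rw [← norm_pow]
      refine Asymptotics.IsBigO.norm_right (Asymptotics.IsBigO.of_bound 1 ?_)
      filter_upwards [Metric.closedBall_mem_nhds (0 : ℝ) one_pos] with t ht
      rw [mem_closedBall_zero_iff] at ht
      simpa only [norm_pow, one_mul] using pow_le_pow_of_le_one (norm_nonneg t) ht hn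
    have h3 : (fun t : ℝ => a n * t ^ n) =O[𝓝 0] fun t : ℝ => ‖t‖ ^ (n + 1) := by
      refine (h2.sub h1).congr_left fun t => ?_
      have : ∑ i ∈ Finset.range n, a i * t ^ i = 0 :=
        Finset.sum_eq_zero fun i hi => by
          rw [ih i (Finset.mem_range.mp hi) ((Finset.mem_range.mp hi).trans hn), zero_mul]
      simp [FormalMultilinearSeries.partialSum, Finset.sum_range_succ,
        FormalMultilinearSeries.ofScalars, this]
    have h4 := Asymptotics.IsBigO.continuousMultilinearMap_apply_eq_zero
      (p := FormalMultilinearSeries.ofScalars ℝ a n)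
      (h3.congr_left fun t => by simp [FormalMultilinearSeries.ofScalars]) 1
    simpa [FormalMultilinearSeries.ofScalars] using h4

/-- The integral of `r ^ Y` for a Poisson random variable `Y`. -/
lemma integral_rpow_of_poisson {Ω : Type*} [MeasurableSpace Ω] (μ : Measure Ω)
    [IsProbabilityMeasure μ] {Y : Ω → ℝ} (hYm : Measurable Y) {α : ℝ} (hα : 0 < α)
    (hlaw : ∀ j : ℕ, μ {ω | Y ω = (j : ℝ)}
      = ENNReal.ofReal (Real.exp (-α) * α ^ j / (j.factorial : ℝ))) {r : ℝ} (hr : 0 < r) :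
    ∫ ω, r ^ Y ω ∂μ = Real.exp (α * (r - 1)) := by
  have hexp (y : ℝ) : HasSum (fun j : ℕ => y ^ j / (j.factorial : ℝ)) (Real.exp y) := by
    rw [Real.exp_eq_exp_ℝ]
    exact NormedSpace.expSeries_div_hasSum_exp y
  have hS (j : ℕ) : MeasurableSet {ω | Y ω = (j : ℝ)} := hYm (measurableSet_singleton _)
  have hd : Pairwise (Function.onFun Disjoint fun j : ℕ => {ω | Y ω = (j : ℝ)}) := by
    intro i j hij
    refine Set.disjoint_left.mpr fun ω hi hj => hij ?_
    exact_mod_cast (hi : Y ω = i).symm.trans hj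
  have hU : μ (⋃ j : ℕ, {ω | Y ω = (j : ℝ)}) = 1 := by
    rw [measure_iUnion hd hS]
    simp_rw [hlaw]
    have h := (hexp α).mul_left (Real.exp (-α))
    simp_rw [← mul_div_assoc] at h
    rw [← ENNReal.ofReal_tsum_of_nonneg (fun j => by positivity) h.summable, h.tsum_eq,
      ← Real.exp_add]
    simp
  have hUm : ∀ᵐ ω ∂μ, ω ∈ ⋃ j : ℕ, {ω | Y ω = (j : ℝ)} :=
    (prob_compl_eq_zero_iff (MeasurableSet.iUnion hS)).mpr hU
  have hconst (j : ℕ) {g : ℝ → ℝ} :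
      ∫ ω in {ω | Y ω = (j : ℝ)}, g (Y ω) ∂μ
        = Real.exp (-α) * α ^ j / (j.factorial : ℝ) * g j := by
    rw [setIntegral_congr_fun (g := fun _ => g j) (hS j) fun ω hω => by
      rw [show Y ω = j from hω]]
    rw [setIntegral_const, Measure.real, hlaw, ENNReal.toReal_ofReal (by positivity),
      smul_eq_mul]
  have hsum : HasSum (fun j : ℕ => ∫ ω in {ω | Y ω = (j : ℝ)}, r ^ Y ω ∂μ)
      (Real.exp (α * (r - 1))) := by
    convert (hexp (α * r)).mul_left (Real.exp (-α)) using 1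
    · rfl
    · ext j
      rw [hconst j (g := fun y => r ^ y), Real.rpow_natCast]
      ring
    · rw [← Real.exp_add]
      ring_nf
  have hint : IntegrableOn (fun ω => r ^ Y ω) (⋃ j : ℕ, {ω | Y ω = (j : ℝ)}) μ := by
    refine integrableOn_iUnion_of_summable_integral_norm (fun j => ?_) ?_
    · refine (integrableOn_const (C := r ^ (j : ℝ)) (by finiteness)).congr_fun
        (fun ω hω => ?_) (hS j)
      simp only [show Y ω = j from hω]
    · simpa [abs_of_pos (Real.rpow_pos_of_pos hr _)] using hsum.summable
  rw [← Measure.restrict_eq_self_of_ae_mem hUm]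
  exact (hasSum_integral_iUnion hS hd hint).unique hsum

lemma degExp_pos {lam t : ℝ} (ht : 0 < 1 + lam * t) (y : ℝ) : 0 < degExp lam y t := by
  unfold degExp
  split_ifs <;> positivity

lemma degExp_eq_rpow {lam t : ℝ} (ht : 0 < 1 + lam * t) (y : ℝ) :
    degExp lam y t = degExp lam 1 t ^ y := by
  unfold degExp
  split_ifs
  · rw [← Real.exp_mul]
    ring_nf
  · rw [← Real.rpow_mul ht.le]
    ring_nf

lemma degExp_zero_right (lam y : ℝ) : degExp lam y 0 = 1 := by
  simp [degExp]

/-- The Taylor remainder of `exp ∘ u` is `O(t ^ N)` when `u = O(t)`. -/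
lemma exp_sub_sum_isBigO {u : ℝ → ℝ} (hu : u =O[𝓝 0] fun t : ℝ => t) {N : ℕ} (hN : 0 < N) :
    (fun t => Real.exp (u t) - ∑ j ∈ Finset.range N, u t ^ j / (j.factorial : ℝ))
      =O[𝓝 0] fun t => t ^ N := by
  refine Asymptotics.IsBigO.trans ?_ (hu.pow N)
  have h0 : Tendsto u (𝓝 0) (𝓝 0) := hu.trans_tendsto tendsto_id
  refine Asymptotics.IsBigO.of_bound ((N.succ : ℝ) / (N.factorial * N)) ?_
  filter_upwards [h0.eventually (Metric.closedBall_mem_nhds 0 one_pos)] with t ht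
  rw [Real.dist_0_eq_abs] at ht
  simpa [mul_comm] using Real.exp_bound ht hN

/-- **Theorem 2.9.** For `Y` Poisson with parameter `α > 0`:
`B_{k,n}^Y(x|λ)/k! = C_λ(x,k) C(n,k) ∑_{j=0}^{n-k} α^j (1-x)^j {n-k brace j}_λ`. -/
theorem poisson_probabilistic_degenerate_Bernstein_eq_sum_degStirling
    {Ω : Type*} [MeasurableSpace Ω] (μ : Measure Ω) [IsProbabilityMeasure μ]
    (Y : Ω → ℝ) (hYm : Measurable Y)
    (α : ℝ) (hα : 0 < α)
    -- `Y` is Poisson with parameter `α`: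
    (hlaw : ∀ j : ℕ, μ {ω | Y ω = (j : ℝ)}
      = ENNReal.ofReal (Real.exp (-α) * α ^ j / (j.factorial : ℝ)))
    (lam x : ℝ) (hx : x ∈ Set.Icc (0 : ℝ) 1)
    -- degenerate Stirling numbers of the second kind:
    (dSt : ℕ → ℕ → ℝ)
    (hdSt0 : ∀ n k : ℕ, n < k → dSt n k = 0)
    (hdSt : ∀ k : ℕ, ∀ᶠ t in 𝓝 (0 : ℝ),
      HasSum (fun n : ℕ => dSt n k * t ^ n / (n.factorial : ℝ))
        ((1 / (k.factorial : ℝ)) * (degExp lam 1 t - 1) ^ k))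
    -- probabilistic degenerate Bernstein polynomials:
    (B : ℕ → ℕ → ℝ)
    (hB0 : ∀ k n : ℕ, n < k → B k n = 0)
    (hB : ∀ k : ℕ, ∀ᶠ t in 𝓝 (0 : ℝ),
      HasSum (fun n : ℕ => B k n * t ^ n / (n.factorial : ℝ))
        ((1 / (k.factorial : ℝ)) * degFallFac lam x k * t ^ k *
          (∫ ω, degExp lam (Y ω) t ∂μ) ^ (1 - x)))
    (n k : ℕ) (hkn : k ≤ n) :
    B k n / (k.factorial : ℝ) = degBinom lam x k * (n.choose k : ℝ) *
      ∑ j ∈ Finset.range (n - k + 1), α ^ j * (1 - x) ^ j * dSt (n - k) j := by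
  set c := α * (1 - x) with hc
  set K := (1 / (k.factorial : ℝ)) * degFallFac lam x k with hK
  set m := n - k with hm
  have hu : (fun t => c * (degExp lam 1 t - 1)) =O[𝓝 0] fun t : ℝ => t := by
    have hp : HasFPowerSeriesAt (fun t => degExp lam 1 t - 1)
        (FormalMultilinearSeries.ofScalars ℝ fun i => dSt i 1 / (i.factorial : ℝ)) 0 := by
      rw [hasFPowerSeriesAt_iff]
      filter_upwards [hdSt 1] with t ht
      simpa [FormalMultilinearSeries.coeff_ofScalars, mul_comm, mul_div_assoc, mul_left_comm,
        div_eq_mul_inv] using ht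
    have h := hp.differentiableAt.isBigO_sub
    simp only [degExp_zero_right, sub_self, sub_zero] at h
    exact h.const_mul_left c
  have hP : ∀ᶠ t in 𝓝 (0 : ℝ), HasSum
      (fun i : ℕ => (∑ j ∈ Finset.range (m + 1), c ^ j * dSt i j) / (i.factorial : ℝ) * t ^ i)
      (∑ j ∈ Finset.range (m + 1), (c * (degExp lam 1 t - 1)) ^ j / (j.factorial : ℝ)) := by
    filter_upwards [(eventually_all_finset (Finset.range (m + 1))).mpr fun j _ => hdSt j]
      with t ht
    convert hasSum_sum fun j hj => (ht j hj).mul_left (c ^ j) using 1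
    · rfl
    · ext i
      rw [Finset.sum_div, Finset.sum_mul]
      exact Finset.sum_congr rfl fun j _ => by ring
    · exact Finset.sum_congr rfl fun j _ => by rw [mul_pow]; ring
  have hM : ∀ᶠ t in 𝓝 (0 : ℝ), (∫ ω, degExp lam (Y ω) t ∂μ) ^ (1 - x)
      = Real.exp (c * (degExp lam 1 t - 1)) := by
    have hpos : ∀ᶠ t in 𝓝 (0 : ℝ), 0 < 1 + lam * t :=
      (by fun_prop : Continuous fun t : ℝ => 1 + lam * t).continuousAt.eventually_const_lt
        (by simp)
    filter_upwards [hpos] with t ht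
    simp_rw [fun ω => degExp_eq_rpow ht (Y ω)]
    rw [integral_rpow_of_poisson μ hYm hα hlaw (degExp_pos ht 1), ← Real.exp_mul, hc]
    ring_nf
  have hD : ∀ᶠ t in 𝓝 (0 : ℝ), HasSum
      (fun i : ℕ => (B k i / (i.factorial : ℝ) - if k ≤ i then
        K * ((∑ j ∈ Finset.range (m + 1), c ^ j * dSt (i - k) j) / ((i - k).factorial : ℝ))
          else 0) * t ^ i)
      (K * t ^ k * (Real.exp (c * (degExp lam 1 t - 1)) -
        ∑ j ∈ Finset.range (m + 1), (c * (degExp lam 1 t - 1)) ^ j / (j.factorial : ℝ))) := by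
    filter_upwards [hB k, hP, hM] with t hBt hPt hMt
    rw [hMt] at hBt
    rw [mul_sub (K * t ^ k)]
    simp_rw [sub_mul]
    refine HasSum.sub (by simp_rw [div_mul_eq_mul_div]; exact hBt) ?_
    rw [← (add_left_injective k).hasSum_iff fun i hi => ?_]
    · convert hPt.mul_left (K * t ^ k) using 1
      · rfl
      · ext i
        simp only [Function.comp_apply, le_add_iff_nonneg_left, zero_le, if_true,
          Nat.add_sub_cancel, pow_add]
        ring
    · rw [if_neg fun h => hi ⟨i - k, Nat.sub_add_cancel h⟩, zero_mul]
  have hO := ((Asymptotics.isBigO_refl (fun t : ℝ => t ^ k) (𝓝 0)).const_mul_left K).mul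
    (exp_sub_sum_isBigO hu m.succ_pos)
  simp_rw [← pow_add] at hO
  have h := coeff_eq_zero_of_hasSum_of_isBigO_s8 hD hO (n := n) (by omega)
  rw [if_pos hkn, sub_eq_zero, div_eq_iff (by positivity)] at h
  rw [h, Nat.cast_choose ℝ hkn, degBinom, hK]
  simp_rw [← mul_pow, ← hc, ← hm]
  field_simp
end

section
/- Let λ ∈ ℝ, let m be a positive integer and 0 < p ≤ 1, let Y be a binomial random variable with parameters m and p, let x ∈ [0,1], and let n ≥ k ≥ 0 be integers. Then B_{k,n}^Y(x|λ)/k! = C(n,k) · C_λ(x,k) · ∑_{j=0}^{n−k} C(m(1−x), j) · j! · p^j · {n−k \brace j}_λ. -/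
open MeasureTheory Filter Finset Topology

/-- A function that is the sum of a power series near `0` agrees with the `N`-th partial sum
up to `O(t ^ N)`. -/
theorem isBigO_sub_sum_range_of_hasSum_pow {f : ℝ → ℝ} {a : ℕ → ℝ}
    (h : ∀ᶠ t in 𝓝 (0 : ℝ), HasSum (fun n : ℕ => a n * t ^ n) (f t)) (N : ℕ) :
    (fun t => f t - ∑ i ∈ range N, a i * t ^ i) =O[𝓝 0] fun t : ℝ => t ^ N := by
  have hf : HasFPowerSeriesAt f (FormalMultilinearSeries.ofScalars ℝ a) 0 := by
    rw [hasFPowerSeriesAt_iff]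
    filter_upwards [h] with t ht
    simpa [FormalMultilinearSeries.coeff_ofScalars, mul_comm] using ht
  have := hf.isBigO_sub_partialSum_pow N
  simp only [zero_add] at this
  refine (this.congr_left fun t => ?_).trans
    (Asymptotics.IsBigO.of_norm_right (by simpa using Asymptotics.isBigO_refl _ _))
  simp [FormalMultilinearSeries.partialSum, FormalMultilinearSeries.coeff_ofScalars, mul_comm]

/-- A polynomial of degree less than `N` that is `O(t ^ N)` at `0` has vanishing coefficients. -/
theorem coeff_eq_zero_of_sum_range_isBigO {a : ℕ → ℝ} {N : ℕ}
    (h : (fun t : ℝ => ∑ i ∈ range N, a i * t ^ i) =O[𝓝 0] fun t : ℝ => t ^ N) :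
    ∀ i < N, a i = 0 := by
  induction N with
  | zero => simp
  | succ N ih =>
    have hlt : (fun t : ℝ => t ^ (N + 1)) =o[𝓝 0] fun t : ℝ => t ^ N :=
      Asymptotics.isLittleO_pow_pow N.lt_succ_self
    have hlow : ∀ i < N, a i = 0 := by
      refine ih (((h.trans hlt.isBigO).sub
        ((Asymptotics.isBigO_refl (fun t : ℝ => t ^ N) (𝓝 0)).const_mul_left (a N))).congr_left
          fun t => ?_)
      simp [sum_range_succ]
    have htop : a N = 0 := by
      by_contra hne
      have hmon : (fun t : ℝ => a N * t ^ N) =o[𝓝 0] fun t : ℝ => t ^ N := by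
        refine (h.trans_isLittleO hlt).congr_left fun t => ?_
        rw [sum_range_succ, sum_eq_zero fun i hi => by simp [hlow i (mem_range.1 hi)], zero_add]
      rw [Asymptotics.isLittleO_const_mul_left_iff hne] at hmon
      refine Asymptotics.isLittleO_irrefl ?_ hmon
      have hfreq : ∃ᶠ t : ℝ in 𝓝[≠] 0, t ^ N ≠ 0 :=
        Eventually.frequently <|
          eventually_mem_nhdsWithin.mono fun t (ht : t ∈ ({0}ᶜ : Set ℝ)) => pow_ne_zero N ht
      exact hfreq.filter_mono nhdsWithin_le_nhds
    intro i hi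
    rcases Nat.lt_succ_iff_lt_or_eq.1 hi with hi | rfl
    exacts [hlow i hi, htop]

theorem ringChoose_eq_genBinom (a : ℝ) (j : ℕ) : Ring.choose a j = genBinom a j := by
  have h : (descPochhammer ℤ j).smeval a = ∏ i ∈ range j, (a - (i : ℝ)) := by
    induction j with
    | zero => simp
    | succ j ih =>
      simp [descPochhammer_succ_right, Polynomial.smeval_mul, Polynomial.smeval_natCast, ih,
        prod_range_succ]
  rw [Ring.choose_eq_smul, h, genBinom, smul_eq_mul, div_eq_inv_mul]

theorem one_add_rpow_sub_sum_genBinom_isBigO (a : ℝ) (N : ℕ) :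
    (fun u : ℝ => (1 + u) ^ a - ∑ j ∈ range N, genBinom a j * u ^ j) =O[𝓝 0]
      fun u : ℝ => u ^ N := by
  refine isBigO_sub_sum_range_of_hasSum_pow ?_ N
  have h := hasFPowerSeriesAt_iff.1 (Real.one_add_rpow_hasFPowerSeriesAt_zero (a := a))
  filter_upwards [h] with t ht
  simpa [binomialSeries, FormalMultilinearSeries.coeff_ofScalars, mul_comm,
    ringChoose_eq_genBinom] using ht

theorem degExp_natCast {lam t : ℝ} (h : 0 < 1 + lam * t) (j : ℕ) :
    degExp lam j t = degExp lam 1 t ^ j := by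
  unfold degExp
  split_ifs
  · rw [← Real.exp_nat_mul, one_mul]
  · rw [← Real.rpow_mul_natCast h.le]
    ring_nf

/-- The expectation of a function of a binomial random variable. -/
theorem integral_comp_of_binomial_law {Ω : Type*} [MeasurableSpace Ω] {μ : Measure Ω}
    [IsProbabilityMeasure μ] {Y : Ω → ℝ} (hYm : Measurable Y) {m : ℕ} {p : ℝ} (hp0 : 0 ≤ p)
    (hp1 : p ≤ 1)
    (hlaw : ∀ j : ℕ, μ {ω | Y ω = (j : ℝ)}
      = ENNReal.ofReal ((m.choose j : ℝ) * p ^ j * (1 - p) ^ (m - j))) (g : ℝ → ℝ) :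
    ∫ ω, g (Y ω) ∂μ
      = ∑ j ∈ range (m + 1), (m.choose j : ℝ) * p ^ j * (1 - p) ^ (m - j) * g j := by
  have hq : 0 ≤ 1 - p := sub_nonneg.2 hp1
  have hw : ∀ j, 0 ≤ (m.choose j : ℝ) * p ^ j * (1 - p) ^ (m - j) := fun j => by positivity
  have hmeas : ∀ j : ℕ, MeasurableSet {ω | Y ω = (j : ℝ)} := fun j =>
    hYm (measurableSet_singleton _)
  have hdisj : Pairwise (Function.onFun Disjoint fun j : ℕ => {ω | Y ω = (j : ℝ)}) := by
    intro i j hij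
    refine Set.disjoint_left.2 fun ω hi hj => hij ?_
    exact_mod_cast (show Y ω = i from hi).symm.trans hj
  have hsum : ∑ j ∈ range (m + 1), (m.choose j : ℝ) * p ^ j * (1 - p) ^ (m - j) = 1 := by
    have := add_pow p (1 - p) m
    rw [add_sub_cancel, one_pow] at this
    refine Eq.trans (sum_congr rfl fun j _ => ?_) this.symm
    ring
  have hone : μ (⋃ j ∈ range (m + 1), {ω | Y ω = (j : ℝ)}) = 1 := by
    rw [measure_biUnion_finset (hdisj.set_pairwise _) fun j _ => hmeas j,
      sum_congr rfl fun j _ => hlaw j, ← ENNReal.ofReal_sum_of_nonneg fun j _ => hw j, hsum,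
      ENNReal.ofReal_one]
  have hae : ∀ᵐ ω ∂μ, ω ∈ ⋃ j ∈ range (m + 1), {ω | Y ω = (j : ℝ)} :=
    (mem_ae_iff_prob_eq_one
      ((range (m + 1)).measurableSet_biUnion fun j _ => hmeas j)).2 hone
  have hcongr : (fun ω => g (Y ω)) =ᵐ[μ] fun ω =>
      ∑ j ∈ range (m + 1), {ω | Y ω = (j : ℝ)}.indicator (fun _ => g j) ω := by
    filter_upwards [hae] with ω hω
    simp only [Set.mem_iUnion, Set.mem_ofPred_eq, exists_prop] at hω
    obtain ⟨i, hi, hYi⟩ := hω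
    rw [sum_eq_single_of_mem i hi]
    · simp [hYi]
    · intro j _ hji
      have : (i : ℝ) ≠ j := by exact_mod_cast hji.symm
      simp [hYi, this]
  rw [integral_congr_ae hcongr, integral_finsetSum _ fun j _ =>
    (integrable_const _).indicator (hmeas j)]
  refine sum_congr rfl fun j _ => ?_
  rw [integral_indicator_const _ (hmeas j), measureReal_def, hlaw, ENNReal.toReal_ofReal (hw j),
    smul_eq_mul]

/-- The degenerate moment generating function of a binomial random variable. -/
theorem integral_degExp_of_binomial_law {Ω : Type*} [MeasurableSpace Ω] {μ : Measure Ω}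
    [IsProbabilityMeasure μ] {Y : Ω → ℝ} (hYm : Measurable Y) {m : ℕ} {p : ℝ} (hp0 : 0 ≤ p)
    (hp1 : p ≤ 1)
    (hlaw : ∀ j : ℕ, μ {ω | Y ω = (j : ℝ)}
      = ENNReal.ofReal ((m.choose j : ℝ) * p ^ j * (1 - p) ^ (m - j)))
    {lam t : ℝ} (ht : 0 < 1 + lam * t) :
    ∫ ω, degExp lam (Y ω) t ∂μ = (1 + p * (degExp lam 1 t - 1)) ^ m := by
  rw [integral_comp_of_binomial_law hYm hp0 hp1 hlaw fun y => degExp lam y t,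
    show 1 + p * (degExp lam 1 t - 1) = p * degExp lam 1 t + (1 - p) by ring, add_pow]
  refine sum_congr rfl fun j _ => ?_
  rw [degExp_natCast ht]
  ring

/-- **Theorem 2.11.** For `Y` binomial with parameters `m, p`:
`B_{k,n}^Y(x|λ)/k! = C(n,k) C_λ(x,k) ∑_{j=0}^{n-k} C(m(1-x),j) j! p^j {n-k brace j}_λ`. -/
theorem binomial_probabilistic_degenerate_Bernstein_eq_sum_degStirling
    {Ω : Type*} [MeasurableSpace Ω] (μ : Measure Ω) [IsProbabilityMeasure μ]
    (Y : Ω → ℝ) (hYm : Measurable Y)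
    (m : ℕ) (hm : 0 < m) (p : ℝ) (hp0 : 0 < p) (hp1 : p ≤ 1)
    -- `Y` is binomial with parameters `m` and `p`:
    (hlaw : ∀ j : ℕ, μ {ω | Y ω = (j : ℝ)}
      = ENNReal.ofReal ((m.choose j : ℝ) * p ^ j * (1 - p) ^ (m - j)))
    (lam x : ℝ) (hx : x ∈ Set.Icc (0 : ℝ) 1)
    -- degenerate Stirling numbers of the second kind:
    (dSt : ℕ → ℕ → ℝ)
    (hdSt0 : ∀ n k : ℕ, n < k → dSt n k = 0)
    (hdSt : ∀ k : ℕ, ∀ᶠ t in 𝓝 (0 : ℝ),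
      HasSum (fun n : ℕ => dSt n k * t ^ n / (n.factorial : ℝ))
        ((1 / (k.factorial : ℝ)) * (degExp lam 1 t - 1) ^ k))
    -- probabilistic degenerate Bernstein polynomials:
    (B : ℕ → ℕ → ℝ)
    (hB0 : ∀ k n : ℕ, n < k → B k n = 0)
    (hB : ∀ k : ℕ, ∀ᶠ t in 𝓝 (0 : ℝ),
      HasSum (fun n : ℕ => B k n * t ^ n / (n.factorial : ℝ))
        ((1 / (k.factorial : ℝ)) * degFallFac lam x k * t ^ k *
          (∫ ω, degExp lam (Y ω) t ∂μ) ^ (1 - x)))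
    (n k : ℕ) (hkn : k ≤ n) :
    B k n / (k.factorial : ℝ) = (n.choose k : ℝ) * degBinom lam x k *
      ∑ j ∈ Finset.range (n - k + 1),
        genBinom ((m : ℝ) * (1 - x)) j * (j.factorial : ℝ) * p ^ j * dSt (n - k) j := by
  obtain ⟨N, rfl⟩ := Nat.exists_eq_add_of_le hkn
  rw [Nat.add_sub_cancel_left]
  set u : ℝ → ℝ := fun t => degExp lam 1 t - 1
  set a : ℝ := (m : ℝ) * (1 - x)
  have hSt : ∀ j M : ℕ, (fun t => 1 / (j.factorial : ℝ) * u t ^ j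
      - ∑ i ∈ range M, dSt i j / (i.factorial : ℝ) * t ^ i) =O[𝓝 0] fun t : ℝ => t ^ M :=
    fun j M => isBigO_sub_sum_range_of_hasSum_pow
      ((hdSt j).mono fun t ht => by simpa only [div_mul_eq_mul_div] using ht) M
  have huO : u =O[𝓝 0] fun t : ℝ => t := by
    simpa [hdSt0 0 1 one_pos] using hSt 1 1
  have hu0 : Tendsto (fun t => p * u t) (𝓝 0) (𝓝 0) := by
    simpa using (huO.trans_tendsto tendsto_id).const_mul p
  have hgen : ∀ᶠ t in 𝓝 (0 : ℝ),
      (∫ ω, degExp lam (Y ω) t ∂μ) ^ (1 - x) = (1 + p * u t) ^ a := by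
    have hlin : Tendsto (fun t : ℝ => 1 + lam * t) (𝓝 0) (𝓝 1) := by
      have : Continuous fun t : ℝ => 1 + lam * t := by fun_prop
      simpa using this.tendsto 0
    have hbase : Tendsto (fun t => 1 + p * u t) (𝓝 0) (𝓝 1) := by
      simpa using hu0.const_add 1
    filter_upwards [hlin.eventually (lt_mem_nhds one_pos),
      hbase.eventually (lt_mem_nhds one_pos)] with t ht hpos
    rw [integral_degExp_of_binomial_law hYm hp0.le hp1 hlaw ht, ← Real.rpow_natCast,
      ← Real.rpow_mul hpos.le]
  have hbin : (fun t => (1 + p * u t) ^ a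
      - ∑ j ∈ range (N + 1), genBinom a j * (p * u t) ^ j) =O[𝓝 0]
        fun t : ℝ => t ^ (N + 1) :=
    ((one_add_rpow_sub_sum_genBinom_isBigO a (N + 1)).comp_tendsto hu0).trans
      ((huO.const_mul_left p).pow (N + 1))
  set s : ℕ → ℝ := fun i => (∑ j ∈ range (N + 1),
    genBinom a j * (j.factorial : ℝ) * p ^ j * dSt i j) / (i.factorial : ℝ) with hs
  have hcomp : (fun t => (1 + p * u t) ^ a - ∑ i ∈ range (N + 1), s i * t ^ i) =O[𝓝 0]
      fun t : ℝ => t ^ (N + 1) := by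
    have hsum := Asymptotics.IsBigO.fun_sum (s := range (N + 1)) fun j _ =>
      (hSt j (N + 1)).const_mul_left (genBinom a j * (j.factorial : ℝ) * p ^ j)
    refine (hbin.add hsum).congr_left fun t => ?_
    simp only [mul_sub, sum_sub_distrib]
    have h₁ : ∑ j ∈ range (N + 1), genBinom a j * (j.factorial : ℝ) * p ^ j *
        (1 / (j.factorial : ℝ) * u t ^ j)
        = ∑ j ∈ range (N + 1), genBinom a j * (p * u t) ^ j :=
      sum_congr rfl fun j _ => by
        have := Nat.cast_ne_zero (R := ℝ).2 j.factorial_ne_zero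
        rw [mul_pow]
        field_simp
    have h₂ : ∑ j ∈ range (N + 1), genBinom a j * (j.factorial : ℝ) * p ^ j *
        ∑ i ∈ range (N + 1), dSt i j / (i.factorial : ℝ) * t ^ i
        = ∑ i ∈ range (N + 1), s i * t ^ i := by
      simp only [hs, mul_sum, sum_div, sum_mul]
      rw [sum_comm]
      exact sum_congr rfl fun i _ => sum_congr rfl fun j _ => by ring
    rw [h₁, h₂]
    ring
  set K : ℝ := 1 / (k.factorial : ℝ) * degFallFac lam x k with hK
  have hBk : (fun t => K * t ^ k * (1 + p * u t) ^ a
      - ∑ i ∈ range (k + (N + 1)), B k i / (i.factorial : ℝ) * t ^ i) =O[𝓝 0]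
        fun t : ℝ => t ^ (k + (N + 1)) :=
    isBigO_sub_sum_range_of_hasSum_pow (by
      filter_upwards [hB k, hgen] with t ht hg
      rw [hg] at ht
      convert ht using 2 with i
      ring) _
  have hmul : (fun t => K * t ^ k * ((1 + p * u t) ^ a - ∑ i ∈ range (N + 1), s i * t ^ i))
      =O[𝓝 0] fun t : ℝ => t ^ (k + (N + 1)) := by
    simp only [pow_add _ k]
    exact ((Asymptotics.isBigO_refl (fun t : ℝ => t ^ k) (𝓝 0)).const_mul_left K).mul hcomp
  have hcoeff := coeff_eq_zero_of_sum_range_isBigO (N := k + (N + 1))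
    (a := fun i => (if k ≤ i then K * s (i - k) else 0) - B k i / (i.factorial : ℝ))
    ((hBk.sub hmul).congr_left fun t => by
      simp only [sub_mul, sum_sub_distrib]
      have hlow : ∑ i ∈ range k, (if k ≤ i then K * s (i - k) else 0) * t ^ i = 0 :=
        sum_eq_zero fun i hi => by simp [not_le.2 (mem_range.1 hi)]
      have hshift : ∑ i ∈ range (k + (N + 1)), (if k ≤ i then K * s (i - k) else 0) * t ^ i
          = K * t ^ k * ∑ i ∈ range (N + 1), s i * t ^ i := by
        rw [sum_range_add, hlow, zero_add, mul_sum]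
        refine sum_congr rfl fun i _ => ?_
        rw [if_pos (Nat.le_add_right k i), Nat.add_sub_cancel_left]
        ring
      rw [hshift]
      ring) (k + N) (by omega)
  simp only [Nat.le_add_right, if_true, Nat.add_sub_cancel_left] at hcoeff
  have hfac : ∀ i : ℕ, (i.factorial : ℝ) ≠ 0 := fun i =>
    Nat.cast_ne_zero.2 i.factorial_ne_zero
  have hBval : B k (k + N) = K * s N * ((k + N).factorial : ℝ) := by
    rw [sub_eq_zero, eq_div_iff (hfac _)] at hcoeff
    exact hcoeff.symm
  rw [hBval, Nat.cast_add_choose, degBinom, hK, hs]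
  have h₁ := hfac k
  have h₂ := hfac N
  field_simp
end
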